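/- arXiv:math/9201288 — 2 statements merged into one kernel-verified Lean document; each statement's English description precedes it below -/
import Mathlib

section
/- For 0 ≤ ε ≤ 1 let q_ε(x) = 1 + ε − (2+ε)x² on [-1,1], let Λ_ε = {x ∈ [-1,1] : q_εⁿ(x) ∈ [-1,1] for all n ≥ 0} be its maximal invariant set, and let HD(ε) be the Hausdorff dimension of Λ_ε. Then there is a constant C > 0, not depending on ε, such that 1 − C^{-1}√ε ≤ HD(ε) ≤ 1 − C√ε for all 0 ≤ ε ≤ 1. -/
open Set MeasureTheory Filter Topology

noncomputable def len (s : Set ℝ) : ℝ := (volume s).toReal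

noncomputable def branch (f : ℝ → ℝ) : Bool → ℝ → ℝ
  | false => Function.invFunOn f (Icc (-1) 0)
  | true => Function.invFunOn f (Icc 0 1)

noncomputable def gw (f : ℝ → ℝ) : List Bool → ℝ → ℝ
  | [] => id
  | b :: w => branch f b ∘ gw f w

noncomputable def Iw (f : ℝ → ℝ) (w : List Bool) : Set ℝ := gw f w '' Icc (-1) 1

def word (a : ℕ → Bool) (n : ℕ) : List Bool := ((List.range (n + 1)).reverse).map a

noncomputable def ratio (f : ℝ → ℝ) (a : ℕ → Bool) (n : ℕ) : ℝ :=
  len (Iw f (word a n)) / len (Iw f ((word a n).dropLast))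

def IsScalingFun (f : ℝ → ℝ) (s : (ℕ → Bool) → ℝ) : Prop :=
  ∀ a : ℕ → Bool, Tendsto (ratio f a) atTop (nhds (s a))

def HolderOnDual (s : (ℕ → Bool) → ℝ) : Prop :=
  ∃ C > (0:ℝ), ∃ lam ∈ Ioo (0:ℝ) 1, ∀ a b : ℕ → Bool, ∀ n : ℕ,
    (∀ k < n, a k = b k) → |s a - s b| ≤ C * lam ^ n

def EvZero (a : ℕ → Bool) : Prop := ∃ N, ∀ n ≥ N, a n = false

def Lambda (f : ℝ → ℝ) : Set ℝ := {x | ∀ n : ℕ, f^[n] x ∈ Icc (-1) 1}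

structure GoodFamily where
  eps0 : ℝ
  eps0_pos : 0 < eps0
  f : ℝ → ℝ → ℝ
  f' : ℝ → ℝ → ℝ
  gamma : ℝ
  one_lt_gamma : 1 < gamma
  mono : ∀ ε ∈ Icc 0 eps0, StrictMonoOn (f ε) (Icc (-1) 0)
  anti : ∀ ε ∈ Icc 0 eps0, StrictAntiOn (f ε) (Icc 0 1)
  map_neg_one : ∀ ε ∈ Icc 0 eps0, f ε (-1) = -1
  map_one : ∀ ε ∈ Icc 0 eps0, f ε 1 = -1
  map_zero : ∀ ε ∈ Icc 0 eps0, f ε 0 = 1 + ε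
  smooth : ContDiffOn ℝ 1 (fun p : ℝ × ℝ => f p.1 p.2) (Icc 0 eps0 ×ˢ Icc (-1) 1)
  deriv_f : ∀ ε ∈ Icc 0 eps0, ∀ x ∈ Icc (-1:ℝ) 1,
    HasDerivWithinAt (f ε) (f' ε x) (Icc (-1) 1) x
  Rneg : ℝ → ℝ → ℝ
  Rpos : ℝ → ℝ → ℝ
  Rneg_cont : ContinuousOn (fun p : ℝ × ℝ => Rneg p.1 p.2) (Icc 0 eps0 ×ˢ Icc (-1) 0)
  Rpos_cont : ContinuousOn (fun p : ℝ × ℝ => Rpos p.1 p.2) (Icc 0 eps0 ×ˢ Icc 0 1)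
  Rneg_ne : ∀ ε ∈ Icc 0 eps0, ∀ x ∈ Icc (-1:ℝ) 0, Rneg ε x ≠ 0
  Rpos_ne : ∀ ε ∈ Icc 0 eps0, ∀ x ∈ Icc (0:ℝ) 1, Rpos ε x ≠ 0
  Rneg_eq : ∀ ε ∈ Icc 0 eps0, ∀ x ∈ Ico (-1:ℝ) 0, Rneg ε x = f' ε x / |x| ^ (gamma - 1)
  Rpos_eq : ∀ ε ∈ Icc 0 eps0, ∀ x ∈ Ioc (0:ℝ) 1, Rpos ε x = f' ε x / |x| ^ (gamma - 1)
  K' : ℝ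
  K'_pos : 0 < K'
  alpha' : ℝ
  alpha'_mem : alpha' ∈ Ioc (0:ℝ) 1
  holder' : ∀ ε ∈ Icc 0 eps0, ∀ x ∈ Icc (-1:ℝ) 1, ∀ y ∈ Icc (-1:ℝ) 1,
    |f' ε x - f' ε y| ≤ K' * |x - y| ^ alpha'
  K'' : ℝ
  K''_pos : 0 < K''
  alpha'' : ℝ
  alpha''_mem : alpha'' ∈ Ioc (0:ℝ) 1
  holder''_neg : ∀ ε ∈ Icc 0 eps0, ∀ x ∈ Ico (-1:ℝ) 0, ∀ y ∈ Ico (-1:ℝ) 0,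
    |f' ε x / |x| ^ (gamma - 1) - f' ε y / |y| ^ (gamma - 1)| ≤ K'' * |x - y| ^ alpha''
  holder''_pos : ∀ ε ∈ Icc 0 eps0, ∀ x ∈ Ioc (0:ℝ) 1, ∀ y ∈ Ioc (0:ℝ) 1,
    |f' ε x / |x| ^ (gamma - 1) - f' ε y / |y| ^ (gamma - 1)| ≤ K'' * |x - y| ^ alpha''
  C0 : ℝ
  C0_pos : 0 < C0
  lam : ℝ
  lam_mem : lam ∈ Ioo (0:ℝ) 1
  decay : ∀ ε ∈ Icc 0 eps0, ∀ n : ℕ, 1 ≤ n → ∀ w : List Bool, w.length = n + 1 →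
    len (Iw (f ε) w) ≤ C0 * lam ^ n

/-- Any finite cover of the invariant set of a separated expanding system has `s`-cost at least
`d ^ s`, where `d` is the separation constant. -/
lemma rpow_le_sum_of_finite_cover {ι : Type*} [Fintype ι] [Nontrivial ι] {K : Set ℝ}
    (hne : K.Nonempty) {g : ι → ℝ → ℝ} (hg : ∀ i, MapsTo (g i) K K) {d s : ℝ} (hd : 0 < d)
    (hsep : ∀ i j, i ≠ j → ∀ x ∈ K, ∀ y ∈ K, d ≤ dist (g i x) (g j y)) {r : ι → ℝ}
    (hr : ∀ i, 0 < r i) (hexp : ∀ i, ∀ x ∈ K, ∀ y ∈ K, r i * dist x y ≤ dist (g i x) (g i y))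
    (hs : 0 < s) (hsum : 1 ≤ ∑ i, r i ^ s) (J : Finset ℕ) :
    ∀ (U : ℕ → Set ℝ) (δ : ℕ → ℝ), (∀ j ∈ J, 0 ≤ δ j) → (K ⊆ ⋃ j ∈ J, U j) →
      (∀ j ∈ J, ∀ x ∈ U j, ∀ y ∈ U j, dist x y ≤ δ j) → d ^ s ≤ ∑ j ∈ J, δ j ^ s := by
  classical
  induction J using Finset.strongInduction with
  | H J ih =>
  intro U δ hδ hK hU
  by_contra! hlt
  have hδd : ∀ j ∈ J, δ j < d := by
    intro j hj
    by_contra! hdj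
    have h1 := Finset.single_le_sum (f := fun j => δ j ^ s)
      (fun i hi => Real.rpow_nonneg (hδ i hi) s) hj
    have h2 := Real.rpow_le_rpow hd.le hdj hs.le
    linarith
  set Js : ι → Finset ℕ := fun i => J.filter (fun j => ∃ x ∈ K, g i x ∈ U j) with hJs
  have hdisj : ∀ i i', i ≠ i' → Disjoint (Js i) (Js i') := by
    intro i i' hii
    rw [Finset.disjoint_left]
    intro j hj hj'
    simp only [hJs, Finset.mem_filter] at hj hj'
    obtain ⟨hjJ, x, hx, hxU⟩ := hj
    obtain ⟨-, y, hy, hyU⟩ := hj'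
    have h1 := hsep i i' hii x hx y hy
    have h2 := hU j hjJ _ hxU _ hyU
    have h3 := hδd j hjJ
    linarith
  have hnonempty : ∀ i, (Js i).Nonempty := by
    intro i
    obtain ⟨x, hx⟩ := hne
    obtain ⟨j, hj, hxj⟩ := mem_iUnion₂.1 (hK (hg i hx))
    exact ⟨j, Finset.mem_filter.2 ⟨hj, x, hx, hxj⟩⟩
  have hssub : ∀ i, Js i ⊂ J := by
    intro i
    refine (Finset.filter_subset _ _).ssubset_of_ne fun h => ?_
    obtain ⟨i', hi'⟩ := exists_ne i
    obtain ⟨j, hj⟩ := hnonempty i'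
    have hjJ : j ∈ J := (Finset.mem_filter.1 hj).1
    have hji : j ∈ Js i := by simp only [hJs] at h ⊢; rw [h]; exact hjJ
    exact Finset.disjoint_left.1 (hdisj i i' hi'.symm) hji hj
  have hpart : ∀ i, r i ^ s * d ^ s ≤ ∑ j ∈ Js i, δ j ^ s := by
    intro i
    have h := ih (Js i) (hssub i) (fun j => K ∩ g i ⁻¹' U j) (fun j => δ j / r i)
      (fun j hj => div_nonneg (hδ j (Finset.mem_filter.1 hj).1) (hr i).le) ?_ ?_
    · have h2 : ∑ j ∈ Js i, (δ j / r i) ^ s = (∑ j ∈ Js i, δ j ^ s) / r i ^ s := by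
        rw [Finset.sum_div]
        refine Finset.sum_congr rfl fun j hj => ?_
        rw [Real.div_rpow (hδ j (Finset.mem_filter.1 hj).1) (hr i).le]
      rw [h2, le_div_iff₀ (Real.rpow_pos_of_pos (hr i) s)] at h
      linarith
    · intro x hx
      obtain ⟨j, hj, hxj⟩ := mem_iUnion₂.1 (hK (hg i hx))
      exact mem_iUnion₂.2 ⟨j, Finset.mem_filter.2 ⟨hj, x, hx, hxj⟩, hx, hxj⟩
    · rintro j hj x ⟨hx, hxU⟩ y ⟨hy, hyU⟩
      rw [le_div_iff₀ (hr i)]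
      have h1 := hexp i x hx y hy
      have h2 := hU j (Finset.mem_filter.1 hj).1 _ hxU _ hyU
      linarith
  have hle : ∑ i, ∑ j ∈ Js i, δ j ^ s ≤ ∑ j ∈ J, δ j ^ s := by
    rw [← Finset.sum_biUnion fun i _ i' _ hii => hdisj i i' hii]
    refine Finset.sum_le_sum_of_subset_of_nonneg ?_ fun j hj _ => Real.rpow_nonneg (hδ j hj) s
    exact Finset.biUnion_subset.2 fun i _ => Finset.filter_subset _ _
  have hds : 0 < d ^ s := Real.rpow_pos_of_pos hd s
  have : (∑ i, r i ^ s) * d ^ s ≤ ∑ i, ∑ j ∈ Js i, δ j ^ s := by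
    rw [Finset.sum_mul]
    exact Finset.sum_le_sum fun i _ => hpart i
  nlinarith

/-- A bounded set can be enlarged to an open set with an arbitrarily small increase of the
`s`-th power of its diameter. -/
lemma exists_isOpen_superset_rpow_le {s : ℝ} (hs : 0 < s) {t : Set ℝ}
    (ht : Metric.ediam t ≠ ⊤) {e : ENNReal} (he : 0 < e) :
    ∃ (U : Set ℝ) (δ : ℝ), IsOpen U ∧ t ⊆ U ∧ 0 ≤ δ ∧ (∀ x ∈ U, ∀ y ∈ U, dist x y ≤ δ) ∧
      ENNReal.ofReal (δ ^ s) ≤ (⨆ _ : t.Nonempty, Metric.ediam t ^ s) + e := by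
  rcases t.eq_empty_or_nonempty with rfl | hne
  · exact ⟨∅, 0, isOpen_empty, subset_rfl, le_rfl, by simp, by simp [Real.zero_rpow hs.ne']⟩
  have hcont : Tendsto (fun ρ : ℝ => ENNReal.ofReal ((Metric.diam t + 2 * ρ) ^ s)) (𝓝 0)
      (𝓝 (ENNReal.ofReal ((Metric.diam t + 2 * 0) ^ s))) := by
    refine (ENNReal.continuous_ofReal.comp (Continuous.rpow_const ?_ ?_)).tendsto 0
    · fun_prop
    · exact fun _ => Or.inr hs.le
  have hval : ENNReal.ofReal ((Metric.diam t + 2 * 0) ^ s) = Metric.ediam t ^ s := by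
    rw [mul_zero, add_zero, ← ENNReal.ofReal_rpow_of_nonneg Metric.diam_nonneg hs.le, Metric.diam,
      ENNReal.ofReal_toReal ht]
  rw [hval] at hcont
  have hlt : Metric.ediam t ^ s < Metric.ediam t ^ s + e :=
    ENNReal.lt_add_right (ENNReal.rpow_ne_top_of_nonneg hs.le ht) he.ne'
  obtain ⟨ρ, hρ, hρ0⟩ := ((hcont.eventually_lt_const hlt).filter_mono
    (nhdsWithin_le_nhds (s := Ioi 0)) |>.and self_mem_nhdsWithin).exists
  have hρ0 : 0 < ρ := hρ0
  refine ⟨Metric.thickening ρ t, Metric.diam t + 2 * ρ, Metric.isOpen_thickening,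
    Metric.self_subset_thickening hρ0 t, by positivity, fun x hx y hy => ?_, ?_⟩
  · obtain ⟨x', hx', hxx⟩ := Metric.mem_thickening_iff.1 hx
    obtain ⟨y', hy', hyy⟩ := Metric.mem_thickening_iff.1 hy
    have h1 := Metric.dist_le_diam_of_mem (Metric.isBounded_iff_ediam_ne_top.2 ht) hx' hy'
    have h2 := dist_triangle4 x x' y' y
    rw [dist_comm y' y] at h2
    linarith
  · rw [iSup_pos hne]
    exact hρ.le

/-- A compact set of zero Hausdorff measure has finite open covers of arbitrarily small cost. -/
lemma exists_finite_cover_of_hausdorffMeasure_eq_zero {K : Set ℝ} (hK : IsCompact K) {s : ℝ}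
    (hs : 0 < s) (h0 : μH[s] K = 0) {η : ℝ} (hη : 0 < η) :
    ∃ (J : Finset ℕ) (U : ℕ → Set ℝ) (δ : ℕ → ℝ), (∀ j ∈ J, 0 ≤ δ j) ∧ (K ⊆ ⋃ j ∈ J, U j) ∧
      (∀ j ∈ J, ∀ x ∈ U j, ∀ y ∈ U j, dist x y ≤ δ j) ∧ ∑ j ∈ J, δ j ^ s < η := by
  have hη2 : ENNReal.ofReal (η / 2) ≠ 0 := by simpa using hη
  obtain ⟨e, he, hesum⟩ := ENNReal.exists_pos_sum_of_countable' hη2 ℕ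
  rw [Measure.hausdorffMeasure_apply] at h0
  have h1 := ENNReal.iSup_eq_zero.1 (ENNReal.iSup_eq_zero.1 h0 1) one_pos
  have h2 : (⨅ (t : ℕ → Set ℝ) (_ : K ⊆ ⋃ n, t n) (_ : ∀ n, Metric.ediam (t n) ≤ 1),
      ∑' n, ⨆ _ : (t n).Nonempty, Metric.ediam (t n) ^ s) < ENNReal.ofReal (η / 2) := by
    rw [h1]; exact pos_iff_ne_zero.2 hη2
  simp only [iInf_lt_iff] at h2
  obtain ⟨t, htK, htd, htsum⟩ := h2
  choose U δ hUo htU hδ hUδ hδe using fun n => exists_isOpen_superset_rpow_le hs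
    (ne_top_of_le_ne_top ENNReal.one_ne_top (htd n)) (he n)
  obtain ⟨J, hJ⟩ := hK.elim_finite_subcover U hUo (htK.trans (iUnion_mono htU))
  refine ⟨J, U, δ, fun j _ => hδ j, hJ, fun j _ => hUδ j, ?_⟩
  rw [← ENNReal.ofReal_lt_ofReal_iff hη,
    ENNReal.ofReal_sum_of_nonneg fun j _ => Real.rpow_nonneg (hδ j) s]
  calc ∑ j ∈ J, ENNReal.ofReal (δ j ^ s)
      ≤ ∑' n, ENNReal.ofReal (δ n ^ s) := ENNReal.sum_le_tsum J
    _ ≤ ∑' n, ((⨆ _ : (t n).Nonempty, Metric.ediam (t n) ^ s) + e n) :=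
        ENNReal.tsum_le_tsum hδe
    _ = (∑' n, ⨆ _ : (t n).Nonempty, Metric.ediam (t n) ^ s) + ∑' n, e n := ENNReal.tsum_add
    _ < ENNReal.ofReal (η / 2) + ENNReal.ofReal (η / 2) := ENNReal.add_lt_add htsum hesum
    _ = ENNReal.ofReal η := by
        rw [← ENNReal.ofReal_add (by positivity) (by positivity), add_halves]

/-- Lower bound for the Hausdorff dimension of a compact set carrying a separated family of
maps with lower Lipschitz constants `r i` such that `∑ r i ^ s ≥ 1`. -/
lemma le_dimH_of_separated_maps {ι : Type*} [Fintype ι] [Nontrivial ι] {K : Set ℝ}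
    (hK : IsCompact K) (hne : K.Nonempty) {g : ι → ℝ → ℝ} (hg : ∀ i, MapsTo (g i) K K)
    (hcont : ∀ i, Continuous (g i)) (hdisj : ∀ i j, i ≠ j → ∀ x ∈ K, ∀ y ∈ K, g i x ≠ g j y)
    {r : ι → ℝ} (hr : ∀ i, 0 < r i)
    (hexp : ∀ i, ∀ x ∈ K, ∀ y ∈ K, r i * dist x y ≤ dist (g i x) (g i y)) {s : ℝ}
    (hs : 0 < s) (hsum : 1 ≤ ∑ i, r i ^ s) : ENNReal.ofReal s ≤ dimH K := by
  have hpair : ∀ p : ι × ι, ∃ d > 0, p.1 ≠ p.2 →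
      ∀ x ∈ K, ∀ y ∈ K, d ≤ dist (g p.1 x) (g p.2 y) := by
    intro p
    by_cases hp : p.1 = p.2
    · exact ⟨1, one_pos, fun h => absurd hp h⟩
    obtain ⟨z, hz, hmin⟩ := (hK.prod hK).exists_isMinOn (hne.prod hne)
      (f := fun z : ℝ × ℝ => dist (g p.1 z.1) (g p.2 z.2))
      (((hcont _).comp continuous_fst).dist ((hcont _).comp continuous_snd)).continuousOn
    exact ⟨_, dist_pos.2 (hdisj _ _ hp z.1 hz.1 z.2 hz.2),
      fun _ x hx y hy => hmin (mk_mem_prod hx hy)⟩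
  choose d hd hsep using hpair
  obtain ⟨p, hp⟩ := Finite.exists_min d
  have hnz : μH[s] K ≠ 0 := fun h0 => by
    obtain ⟨J, U, δ, hδ, hU, hUδ, hlt⟩ := exists_finite_cover_of_hausdorffMeasure_eq_zero hK hs h0
      (Real.rpow_pos_of_pos (hd p) s)
    exact hlt.not_ge (rpow_le_sum_of_finite_cover hne hg (hd p)
      (fun i j hij x hx y hy => (hp (i, j)).trans (hsep (i, j) hij x hx y hy)) hr hexp hs hsum
      J U δ hδ hU hUδ)
  have hcoe : ((s.toNNReal : NNReal) : ℝ) = s := Real.coe_toNNReal s hs.le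
  exact le_dimH_of_hausdorffMeasure_ne_zero (d := s.toNNReal) (by rwa [hcoe])

/-- The inverse branches of `x ↦ 1 + ε - (2 + ε) x ^ 2`: positive for `true`, negative for
`false`. -/
noncomputable def invBranch (ε : ℝ) : Bool → ℝ → ℝ
  | true => fun y => √((1 + ε - y) / (2 + ε))
  | false => fun y => -√((1 + ε - y) / (2 + ε))

/-- The composition of inverse branches along a word. -/
noncomputable def wordMap (ε : ℝ) : List Bool → ℝ → ℝ
  | [] => id
  | b :: w => invBranch ε b ∘ wordMap ε w

/-- The excess contraction of the inverse branches, measured in the metric `dx / √(1 - x ^ 2)`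
and compared with the factor `1 / 2`. -/
noncomputable def excess (ε y : ℝ) : ℝ := √((1 - y) / (1 + ε - y))

/-- The excess contraction of `wordMap`. -/
noncomputable def wordExcess (ε : ℝ) : List Bool → ℝ → ℝ
  | [] => fun _ => 1
  | _ :: w => fun y => excess ε (wordMap ε w y) * wordExcess ε w y

lemma invBranch_sq {ε y : ℝ} (hε : 0 ≤ ε) (hy : y ≤ 1) (b : Bool) :
    invBranch ε b y ^ 2 = (1 + ε - y) / (2 + ε) := by
  have h : 0 ≤ (1 + ε - y) / (2 + ε) := div_nonneg (by linarith) (by linarith)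
  cases b <;> simp [invBranch, Real.sq_sqrt h]

lemma quadratic_invBranch {ε y : ℝ} (hε : 0 ≤ ε) (hy : y ≤ 1) (b : Bool) :
    1 + ε - (2 + ε) * invBranch ε b y ^ 2 = y := by
  rw [invBranch_sq hε hy]
  field_simp
  ring

lemma invBranch_mem {ε y : ℝ} (hε : 0 ≤ ε) (hy : y ∈ Icc (-1) 1) (b : Bool) :
    invBranch ε b y ∈ Icc (-1) 1 := by
  rw [mem_Icc, ← abs_le, ← sq_le_one_iff_abs_le_one, invBranch_sq hε hy.2, div_le_one (by linarith)]
  linarith [hy.1]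

lemma invBranch_true_pos {ε y : ℝ} (hε : 0 < ε) (hy : y ≤ 1) : 0 < invBranch ε true y :=
  Real.sqrt_pos.2 (div_pos (by linarith) (by linarith))

lemma invBranch_false (ε y : ℝ) : invBranch ε false y = -invBranch ε true y := rfl

lemma continuous_invBranch (ε : ℝ) (b : Bool) : Continuous (invBranch ε b) := by
  cases b <;> simp only [invBranch] <;> fun_prop

lemma continuous_wordMap (ε : ℝ) (w : List Bool) : Continuous (wordMap ε w) := by
  induction w with
  | nil => exact continuous_id
  | cons b w ih => exact (continuous_invBranch ε b).comp ih

lemma wordMap_mem {ε y : ℝ} (hε : 0 ≤ ε) (hy : y ∈ Icc (-1) 1) (w : List Bool) :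
    wordMap ε w y ∈ Icc (-1) 1 := by
  induction w with
  | nil => exact hy
  | cons b w ih => exact invBranch_mem hε ih b

lemma invBranch_mem_Ioo {ε y : ℝ} (hε : 0 ≤ ε) (hy : y ∈ Ioo (-1) 1) (b : Bool) :
    invBranch ε b y ∈ Ioo (-1) 1 := by
  rw [mem_Ioo, ← abs_lt, ← sq_lt_one_iff_abs_lt_one, invBranch_sq hε hy.2.le,
    div_lt_one (by linarith)]
  linarith [hy.1]

lemma wordMap_mem_Ioo {ε y : ℝ} (hε : 0 ≤ ε) (hy : y ∈ Ioo (-1) 1) (w : List Bool) :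
    wordMap ε w y ∈ Ioo (-1) 1 := by
  induction w with
  | nil => exact hy
  | cons b w ih => exact invBranch_mem_Ioo hε ih b

lemma excess_nonneg (ε y : ℝ) : 0 ≤ excess ε y := Real.sqrt_nonneg _

lemma excess_le_one {ε y : ℝ} (hε : 0 ≤ ε) (hy : y ≤ 1) : excess ε y ≤ 1 := by
  rw [excess, Real.sqrt_le_one]
  exact div_le_one_of_le₀ (by linarith) (by linarith)

lemma wordExcess_nonneg (ε y : ℝ) (w : List Bool) : 0 ≤ wordExcess ε w y := by
  induction w with
  | nil => exact zero_le_one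
  | cons b w ih => exact mul_nonneg (excess_nonneg _ _) ih

lemma hasDerivAt_invBranch {ε y : ℝ} (hε : 0 < ε) (hy : y ≤ 1) (b : Bool) :
    HasDerivAt (invBranch ε b) (-1 / (2 * (2 + ε) * invBranch ε b y)) y := by
  have hpos : 0 < (1 + ε - y) / (2 + ε) := div_pos (by linarith) (by linarith)
  have h1 : HasDerivAt (fun y => (1 + ε - y) / (2 + ε)) (-1 / (2 + ε)) y := by
    simpa using ((hasDerivAt_id y).const_sub (1 + ε)).div_const (2 + ε)
  have h2 := h1.sqrt hpos.ne'
  have hs := (Real.sqrt_pos.2 hpos).ne'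
  have hε2 : (2 + ε) ≠ 0 := by linarith
  cases b
  · refine h2.neg.congr_deriv ?_
    simp only [invBranch]
    field_simp
  · refine h2.congr_deriv ?_
    simp only [invBranch]
    field_simp

lemma abs_deriv_invBranch {ε y : ℝ} (hε : 0 < ε) (hy : y ∈ Ioo (-1) 1) (b : Bool) :
    |-1 / (2 * (2 + ε) * invBranch ε b y)| * √(1 - y ^ 2) =
      1 / 2 * excess ε y * √(1 - invBranch ε b y ^ 2) := by
  have hb := invBranch_mem_Ioo hε.le hy b
  have hsq := invBranch_sq hε.le hy.2.le b
  have hb0 : invBranch ε b y ≠ 0 := fun h => by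
    rw [h, zero_pow two_ne_zero, eq_comm, div_eq_zero_iff] at hsq
    rcases hsq with h | h <;> linarith [hy.2]
  have h1 : 0 < 1 - y ^ 2 := by nlinarith [hy.1, hy.2]
  have h2 : 0 ≤ (1 - y) / (1 + ε - y) := div_nonneg (by linarith [hy.2]) (by linarith [hy.2])
  have h3 : 0 < 1 - invBranch ε b y ^ 2 := by nlinarith [hb.1, hb.2]
  rw [← sq_eq_sq₀ (by positivity) (by have := excess_nonneg ε y; positivity), mul_pow, sq_abs,
    mul_pow, mul_pow, excess, Real.sq_sqrt h1.le, Real.sq_sqrt h2, Real.sq_sqrt h3.le, div_pow,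
    mul_pow, hsq]
  have : 1 + ε - y ≠ 0 := by linarith [hy.2]
  have : 2 + ε ≠ 0 := by linarith
  field_simp
  ring

/-- The derivative of `wordMap` in the metric `dx / √(1 - x ^ 2)` is `wordExcess / 2 ^ n`. -/
lemma exists_hasDerivAt_wordMap {ε y : ℝ} (hε : 0 < ε) (hy : y ∈ Ioo (-1) 1) (w : List Bool) :
    ∃ D, HasDerivAt (wordMap ε w) D y ∧ |D| * √(1 - y ^ 2) =
      (1 / 2) ^ w.length * wordExcess ε w y * √(1 - wordMap ε w y ^ 2) := by
  induction w with
  | nil => exact ⟨1, hasDerivAt_id y, by simp [wordExcess, wordMap]⟩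
  | cons b w ih =>
    obtain ⟨D, hD, hDabs⟩ := ih
    have hw := wordMap_mem_Ioo hε.le hy w
    refine ⟨_, (hasDerivAt_invBranch hε hw.2.le b).comp y hD, ?_⟩
    rw [abs_mul, mul_assoc, hDabs, mul_left_comm, abs_deriv_invBranch hε hw b]
    simp only [wordExcess, wordMap, List.length_cons, pow_succ, Function.comp_apply]
    ring

lemma invBranch_mem_Lambda {ε y : ℝ} (hε : 0 ≤ ε)
    (hy : y ∈ Lambda (fun x => 1 + ε - (2 + ε) * x ^ 2)) (b : Bool) :
    invBranch ε b y ∈ Lambda (fun x => 1 + ε - (2 + ε) * x ^ 2) := by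
  intro n
  cases n with
  | zero => exact invBranch_mem hε (hy 0) b
  | succ n =>
    rw [Function.iterate_succ_apply]
    have h := quadratic_invBranch hε (hy 0).2 b
    simp only [Function.iterate_zero, id_eq] at h
    rw [h]
    exact hy n

lemma wordMap_mem_Lambda {ε y : ℝ} (hε : 0 ≤ ε)
    (hy : y ∈ Lambda (fun x => 1 + ε - (2 + ε) * x ^ 2)) (w : List Bool) :
    wordMap ε w y ∈ Lambda (fun x => 1 + ε - (2 + ε) * x ^ 2) := by
  induction w with
  | nil => exact hy
  | cons b w ih => exact invBranch_mem_Lambda hε ih b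

lemma exists_wordMap_eq {ε : ℝ} (hε : 0 ≤ ε) (n : ℕ) {x : ℝ}
    (hx : x ∈ Lambda (fun x => 1 + ε - (2 + ε) * x ^ 2)) :
    ∃ w : List Bool, w.length = n ∧ ∃ y ∈ Icc (-1 : ℝ) 1, wordMap ε w y = x := by
  induction n generalizing x with
  | zero => exact ⟨[], rfl, x, hx 0, rfl⟩
  | succ n ih =>
    obtain ⟨w, hw, y, hy, hwy⟩ := ih (x := 1 + ε - (2 + ε) * x ^ 2) fun n => by
      simpa [Function.iterate_succ_apply] using hx (n + 1)
    have hsq : (1 + ε - (1 + ε - (2 + ε) * x ^ 2)) / (2 + ε) = x ^ 2 := by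
      field_simp
      ring
    rcases le_total 0 x with h | h
    · refine ⟨true :: w, by simp [hw], y, hy, ?_⟩
      simp only [wordMap, Function.comp_apply, hwy, invBranch, hsq, Real.sqrt_sq_eq_abs,
        abs_of_nonneg h]
    · refine ⟨false :: w, by simp [hw], y, hy, ?_⟩
      simp only [wordMap, Function.comp_apply, hwy, invBranch, hsq, Real.sqrt_sq_eq_abs,
        abs_of_nonpos h, neg_neg]

lemma eq_of_wordMap_eq {ε x y : ℝ} (hε : 0 < ε) (hx : x ∈ Icc (-1) 1) (hy : y ∈ Icc (-1) 1) :
    ∀ {v w : List Bool}, v.length = w.length → wordMap ε v x = wordMap ε w y → v = w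
  | [], [], _, _ => rfl
  | b :: v, c :: w, hl, h => by
    have hv := wordMap_mem hε.le hx v
    have hw := wordMap_mem hε.le hy w
    simp only [wordMap, Function.comp_apply] at h
    have hbc : b = c := by
      have h1 := invBranch_true_pos hε hv.2
      have h2 := invBranch_true_pos hε hw.2
      cases b <;> cases c <;> simp only [invBranch_false, reduceCtorEq] at h ⊢ <;> linarith
    have htail : wordMap ε v x = wordMap ε w y := by
      rw [← quadratic_invBranch hε.le hv.2 b, h, quadratic_invBranch hε.le hw.2]
    rw [hbc, eq_of_wordMap_eq hε hx hy (by simpa using hl) htail]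

lemma isCompact_Lambda (ε : ℝ) : IsCompact (Lambda (fun x => 1 + ε - (2 + ε) * x ^ 2)) := by
  refine isCompact_Icc.of_isClosed_subset (s := Icc (-1 : ℝ) 1) ?_ fun x hx => hx 0
  have : Lambda (fun x => 1 + ε - (2 + ε) * x ^ 2) =
      ⋂ n : ℕ, (fun x => 1 + ε - (2 + ε) * x ^ 2)^[n] ⁻¹' Icc (-1 : ℝ) 1 := by
    ext x
    simp [Lambda]
  rw [this]
  exact isClosed_iInter fun n => isClosed_Icc.preimage (Continuous.iterate (by fun_prop) n)

/-- The sum of `f` over all words of length `n`. -/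
noncomputable def wordSum (n : ℕ) (f : List Bool → ℝ) : ℝ := ∑ w : Fin n → Bool, f (List.ofFn w)

lemma wordSum_zero (f : List Bool → ℝ) : wordSum 0 f = f [] := by simp [wordSum]

lemma wordSum_succ (n : ℕ) (f : List Bool → ℝ) :
    wordSum (n + 1) f = wordSum n (fun w => f (true :: w)) + wordSum n (fun w => f (false :: w)) := by
  simp only [wordSum]
  rw [← (Fin.consEquiv fun _ : Fin (n + 1) => Bool).sum_comp, Fintype.sum_prod_type,
    Fintype.sum_bool]
  simp [Fin.consEquiv, List.ofFn_succ]

lemma wordSum_mono (n : ℕ) {f g : List Bool → ℝ} (h : ∀ w, f w ≤ g w) :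
    wordSum n f ≤ wordSum n g :=
  Finset.sum_le_sum fun _ _ => h _

lemma wordSum_nonneg (n : ℕ) {f : List Bool → ℝ} (h : ∀ w, 0 ≤ f w) : 0 ≤ wordSum n f :=
  Finset.sum_nonneg fun _ _ => h _

lemma wordSum_add (n : ℕ) (f g : List Bool → ℝ) :
    wordSum n (fun w => f w + g w) = wordSum n f + wordSum n g :=
  Finset.sum_add_distrib

lemma wordSum_const_mul (n : ℕ) (c : ℝ) (f : List Bool → ℝ) :
    wordSum n (fun w => c * f w) = c * wordSum n f :=
  (Finset.mul_sum _ _ _).symm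

lemma wordSum_const (n : ℕ) (c : ℝ) : wordSum n (fun _ => c) = 2 ^ n * c := by
  simp [wordSum]

/-- The length of the initial run of `false` in a word. -/
def falseRun : List Bool → ℕ
  | false :: w => falseRun w + 1
  | _ => 0

/-- The number of occurrences in a word of `true` followed by at least `k` times `false`. -/
def hitCount (k : ℕ) : List Bool → ℕ
  | [] => 0
  | true :: w => hitCount k w + if k ≤ falseRun w then 1 else 0
  | false :: w => hitCount k w

lemma wordSum_hitCount_le_of_falseRun (ρ : ℝ) (hρ : 0 ≤ ρ) (k m j : ℕ) :
    wordSum m (fun w => ρ ^ hitCount k w) ≤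
      wordSum (m + j) (fun w => if j ≤ falseRun w then ρ ^ hitCount k w else 0) := by
  induction j with
  | zero => simp
  | succ j ih =>
    rw [← add_assoc, wordSum_succ]
    simp only [falseRun, hitCount, add_le_add_iff_right]
    refine ih.trans (le_add_of_nonneg_left (wordSum_nonneg _ fun w => ?_))
    split_ifs <;> positivity

lemma wordSum_hitCount_succ (ρ : ℝ) (k n : ℕ) :
    wordSum (n + 1) (fun w => ρ ^ hitCount k w) = 2 * wordSum n (fun w => ρ ^ hitCount k w) -
      (1 - ρ) * wordSum n (fun w => if k ≤ falseRun w then ρ ^ hitCount k w else 0) := by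
  rw [wordSum_succ]
  have : (fun w => ρ ^ hitCount k (true :: w)) = fun w => ρ ^ hitCount k w +
      (-(1 - ρ)) * (if k ≤ falseRun w then ρ ^ hitCount k w else 0) := by
    funext w
    simp only [hitCount]
    split_ifs <;> ring
  rw [this, wordSum_add, wordSum_const_mul]
  simp only [hitCount]
  ring

lemma wordSum_hitCount_le_two_pow_mul {ρ : ℝ} (hρ : 0 ≤ ρ) (hρ1 : ρ ≤ 1) (k m j : ℕ) :
    wordSum (m + j) (fun w => ρ ^ hitCount k w) ≤
      2 ^ j * wordSum m (fun w => ρ ^ hitCount k w) := by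
  induction j with
  | zero => simp
  | succ j ih =>
    rw [← add_assoc, wordSum_hitCount_succ, pow_succ]
    have : 0 ≤ wordSum (m + j) (fun w => if k ≤ falseRun w then ρ ^ hitCount k w else 0) :=
      wordSum_nonneg _ fun w => by split_ifs <;> positivity
    nlinarith

lemma wordSum_hitCount_le {ρ : ℝ} (hρ : 0 ≤ ρ) (hρ1 : ρ ≤ 1) (k m : ℕ) :
    wordSum (k + m) (fun w => ρ ^ hitCount k w) ≤ 2 ^ k * (2 - (1 - ρ) * (1 / 2) ^ k) ^ m := by
  induction m with
  | zero =>
    have h := wordSum_hitCount_le_two_pow_mul hρ hρ1 k 0 k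
    simpa [wordSum_zero, hitCount] using h
  | succ m ih =>
    have h1 := wordSum_hitCount_le_of_falseRun ρ hρ k m k
    have h2 := wordSum_hitCount_le_two_pow_mul hρ hρ1 k m k
    have h3 : (1 / 2 : ℝ) ^ k * 2 ^ k = 1 := by rw [← mul_pow]; norm_num
    rw [add_comm m k] at h1 h2
    have h4 : (1 / 2 : ℝ) ^ k * wordSum (k + m) (fun w => ρ ^ hitCount k w) ≤
        wordSum m (fun w => ρ ^ hitCount k w) := by
      calc _ ≤ (1 / 2 : ℝ) ^ k * (2 ^ k * wordSum m (fun w => ρ ^ hitCount k w)) := by gcongr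
        _ = _ := by rw [← mul_assoc, h3, one_mul]
    have h5 : 0 ≤ 2 - (1 - ρ) * (1 / 2) ^ k := by
      have : (1 / 2 : ℝ) ^ k ≤ 1 := pow_le_one₀ (by norm_num) (by norm_num)
      have : 0 ≤ (1 / 2 : ℝ) ^ k := by positivity
      nlinarith
    rw [← add_assoc, wordSum_hitCount_succ]
    calc _ ≤ (2 - (1 - ρ) * (1 / 2) ^ k) * wordSum (k + m) (fun w => ρ ^ hitCount k w) := by
          nlinarith [mul_le_mul_of_nonneg_left (h4.trans h1) (sub_nonneg.2 hρ1)]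
      _ ≤ (2 - (1 - ρ) * (1 / 2) ^ k) * (2 ^ k * (2 - (1 - ρ) * (1 / 2) ^ k) ^ m) := by gcongr
      _ = _ := by ring

lemma cos_half_le_invBranch_true {ε y t : ℝ} (hε : 0 ≤ ε) (hyt : y ≤ -Real.cos t) :
    Real.cos (t / 2) ≤ invBranch ε true y := by
  refine Real.le_sqrt_of_sq_le ?_
  rw [Real.cos_sq, mul_div_cancel₀ t two_ne_zero, le_div_iff₀ (by linarith)]
  nlinarith [Real.cos_le_one t]

lemma wordMap_le_neg_cos {ε y : ℝ} (hε : 0 ≤ ε) (hy : y ∈ Icc (-1) 1) (k : ℕ) :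
    ∀ w : List Bool, k ≤ falseRun w → wordMap ε w y ≤ -Real.cos (Real.pi / 2 ^ k) := by
  induction k with
  | zero => intro w _; simpa using (wordMap_mem hε hy w).2
  | succ k ih =>
    rintro (_ | ⟨_ | _, w⟩) hw
    · simp [falseRun] at hw
    · have h := cos_half_le_invBranch_true hε (ih w (by simpa [falseRun] using hw))
      rw [div_div, ← pow_succ] at h
      simpa [wordMap, invBranch_false] using h
    · simp [falseRun] at hw

lemma excess_wordMap_le {ε y : ℝ} (hε : 0 < ε) (hy : y ∈ Icc (-1) 1) {k : ℕ}
    (hk : (1 / 4) ^ k ≤ ε) {w : List Bool} (hw : k ≤ falseRun w) :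
    excess ε (wordMap ε (true :: w) y) ≤ 9 / 10 := by
  have h1 := cos_half_le_invBranch_true hε.le (wordMap_le_neg_cos hε.le hy k w hw)
  have h2 := Real.one_sub_sq_div_two_le_cos (x := Real.pi / 2 ^ k / 2)
  have h3 := (wordMap_mem hε.le hy (true :: w)).2
  change _ ≤ wordMap ε (true :: w) y at h1
  have h4 : (Real.pi / 2 ^ k / 2) ^ 2 / 2 = Real.pi ^ 2 / 8 * (1 / 4) ^ k := by
    rw [div_pow, div_pow, ← pow_mul, mul_comm k 2, pow_mul, one_div, inv_pow]
    norm_num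
    ring
  have h5 : Real.pi ^ 2 ≤ 16 := by nlinarith [Real.pi_pos, Real.pi_le_four]
  have h6 : Real.pi ^ 2 / 8 * (1 / 4) ^ k ≤ 2 * ε := by
    have : (0 : ℝ) ≤ (1 / 4) ^ k := by positivity
    nlinarith
  refine Real.sqrt_le_iff.2 ⟨by norm_num, ?_⟩
  rw [div_le_iff₀ (by linarith)]
  linarith

lemma hitCount_cons_le (k : ℕ) (b : Bool) (w : List Bool) :
    hitCount k (b :: w) ≤ hitCount k w + 1 := by
  cases b <;> simp only [hitCount]
  · omega
  · split_ifs <;> omega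

lemma excess_mul_wordExcess_le {ε y : ℝ} (hε : 0 < ε) (hy : y ∈ Icc (-1) 1) {k : ℕ}
    (hk : (1 / 4) ^ k ≤ ε) (w : List Bool) :
    excess ε (wordMap ε w y) * wordExcess ε w y ≤ (9 / 10) ^ hitCount k w := by
  induction w with
  | nil => simpa [wordExcess, hitCount] using excess_le_one hε.le (wordMap_mem hε.le hy []).2
  | cons b w ih =>
    have h1 := excess_le_one hε.le (wordMap_mem hε.le hy (b :: w)).2
    have h2 := excess_nonneg ε (wordMap ε (b :: w) y)
    have h0 := wordExcess_nonneg ε y (b :: w)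
    change wordExcess ε (b :: w) y ≤ _ at ih
    cases b
    · simp only [hitCount]
      nlinarith
    · simp only [hitCount]
      split_ifs with h
      · have h3 := excess_wordMap_le hε hy hk h
        rw [pow_succ]
        nlinarith
      · rw [add_zero]
        nlinarith

lemma wordExcess_le {ε y : ℝ} (hε : 0 < ε) (hy : y ∈ Icc (-1) 1) {k : ℕ}
    (hk : (1 / 4) ^ k ≤ ε) (w : List Bool) :
    wordExcess ε w y ≤ 10 / 9 * (9 / 10) ^ hitCount k w := by
  cases w with
  | nil =>
    simp only [wordExcess, hitCount]
    norm_num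
  | cons b w =>
    have h1 := excess_mul_wordExcess_le hε hy hk w
    have h2 : (9 / 10 : ℝ) ^ (hitCount k w + 1) ≤ (9 / 10) ^ hitCount k (b :: w) :=
      pow_le_pow_of_le_one (by norm_num) (by norm_num) (hitCount_cons_le k b w)
    rw [pow_succ] at h2
    change excess ε (wordMap ε w y) * wordExcess ε w y ≤ _
    linarith

lemma dist_wordMap_le {ε : ℝ} (hε : 0 < ε) {k : ℕ} (hk : (1 / 4) ^ k ≤ ε) (w : List Bool)
    {x y : ℝ} (hx : x ∈ Icc (-1) 1) (hy : y ∈ Icc (-1) 1) :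
    dist (wordMap ε w x) (wordMap ε w y) ≤
      4 * ((1 / 2) ^ w.length * (9 / 10) ^ hitCount k w) := by
  wlog hxy : x < y generalizing x y
  · rcases (not_lt.1 hxy).eq_or_lt with h | h
    · rw [h, dist_self]
      positivity
    · rw [dist_comm]
      exact this hy hx h
  have hmem : ∀ c ∈ Ioo x y, c ∈ Ioo (-1) 1 := fun c hc =>
    ⟨hx.1.trans_lt hc.1, hc.2.trans_le hy.2⟩
  obtain ⟨c, hc, heq⟩ := exists_ratio_hasDerivAt_eq_ratio_slope (wordMap ε w)
    (deriv (wordMap ε w)) hxy (continuous_wordMap ε w).continuousOn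
    (fun c hc => by
      obtain ⟨D, hD, -⟩ := exists_hasDerivAt_wordMap hε (hmem c hc) w
      exact hD.differentiableAt.hasDerivAt)
    Real.arcsin (fun c => 1 / √(1 - c ^ 2)) Real.continuous_arcsin.continuousOn
    (fun c hc => Real.hasDerivAt_arcsin (hmem c hc).1.ne' (hmem c hc).2.ne)
  have hc' := hmem c hc
  obtain ⟨D, hD, hDabs⟩ := exists_hasDerivAt_wordMap hε hc' w
  rw [hD.deriv] at heq
  have hpos : 0 < √(1 - c ^ 2) := Real.sqrt_pos.2 (by nlinarith [hc'.1, hc'.2])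
  have hval : wordMap ε w y - wordMap ε w x =
      (Real.arcsin y - Real.arcsin x) * (D * √(1 - c ^ 2)) := by
    field_simp at heq
    linarith
  have harc : |Real.arcsin y - Real.arcsin x| ≤ Real.pi := by
    have h1 := Real.arcsin_le_pi_div_two x
    have h2 := Real.neg_pi_div_two_le_arcsin x
    have h3 := Real.arcsin_le_pi_div_two y
    have h4 := Real.neg_pi_div_two_le_arcsin y
    rw [abs_le]
    constructor <;> linarith
  have hsq : √(1 - wordMap ε w c ^ 2) ≤ 1 :=
    Real.sqrt_le_one.2 (by nlinarith [sq_nonneg (wordMap ε w c)])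
  rw [dist_comm, Real.dist_eq, hval, abs_mul, abs_mul, abs_of_pos hpos, hDabs]
  have hE := wordExcess_le hε (Ioo_subset_Icc_self hc') hk w
  have hE0 := wordExcess_nonneg ε c w
  calc _ ≤ Real.pi * ((1 / 2) ^ w.length * (10 / 9 * (9 / 10) ^ hitCount k w) * 1) := by gcongr
    _ = Real.pi * (10 / 9) * ((1 / 2) ^ w.length * (9 / 10) ^ hitCount k w) := by ring
    _ ≤ _ := by
      gcongr
      linarith [Real.pi_lt_d2]

/-- The scale `k` with `4 ^ (-k) < ε ≤ 4 ^ (1 - k)`. -/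
lemma exists_scale {ε : ℝ} (hε : 0 < ε) (hε1 : ε ≤ 1) :
    ∃ k : ℕ, 1 ≤ k ∧ (1 / 4) ^ k ≤ ε ∧ ε ≤ 4 * (1 / 4) ^ k ∧ (1 / 2) ^ k ≤ √ε ∧
      √ε ≤ 2 * (1 / 2) ^ k := by
  obtain ⟨n, h1, h2⟩ := exists_nat_pow_near_of_lt_one hε hε1 (y := (1 / 4 : ℝ)) (by norm_num)
    (by norm_num)
  have h3 : ((1 / 2 : ℝ) ^ (n + 1)) ^ 2 = (1 / 4) ^ (n + 1) := by
    rw [← pow_mul, mul_comm, pow_mul]; norm_num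
  have h4 : ε ≤ 4 * (1 / 4) ^ (n + 1) := by rw [pow_succ]; linarith
  refine ⟨n + 1, by omega, h1.le, h4, Real.le_sqrt_of_sq_le (h3 ▸ h1.le), ?_⟩
  rw [Real.sqrt_le_left (by positivity), mul_pow, h3]
  linarith

lemma one_half_rpow_mul_le_one {δ a : ℝ} (hδ : 0 ≤ δ) (ha : a ≤ 2 * (1 - δ)) :
    (1 / 2 : ℝ) ^ (1 - δ) * a ≤ 1 := by
  have h1 : (1 / 2 : ℝ) ^ (1 - δ) = 1 / 2 * Real.exp (δ * Real.log 2) := by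
    rw [Real.rpow_sub (by norm_num), Real.rpow_one, one_div, Real.inv_rpow (by norm_num),
      div_inv_eq_mul, Real.rpow_def_of_pos two_pos, mul_comm δ]
  have h2 : 1 - δ ≤ Real.exp (-δ) := by linarith [Real.add_one_le_exp (-δ)]
  calc (1 / 2 : ℝ) ^ (1 - δ) * a ≤ (1 / 2 : ℝ) ^ (1 - δ) * (2 * Real.exp (-δ)) := by
        gcongr
        linarith
    _ = Real.exp (δ * Real.log 2 - δ) := by
        rw [h1, sub_eq_add_neg, Real.exp_add]
        ring
    _ ≤ 1 := Real.exp_le_one_iff.2 (by nlinarith [Real.log_two_lt_d9])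

lemma wordSum_rpow_le {s : ℝ} (hs : 1 / 2 ≤ s) (hs1 : s ≤ 1) {k : ℕ}
    (hk : (1 - s) * 40 ≤ (1 / 2) ^ k) (m : ℕ) :
    wordSum (k + m) (fun w => (4 * ((1 / 2) ^ (k + m) * (9 / 10) ^ hitCount k w)) ^ s) ≤
      4 * 2 ^ k := by
  have hs0 : 0 ≤ s := by linarith
  have hρ : (9 / 10 : ℝ) ^ s ≤ 19 / 20 := by
    refine (Real.rpow_le_rpow_of_exponent_ge (by norm_num) (by norm_num) hs).trans ?_
    rw [← Real.sqrt_eq_rpow, Real.sqrt_le_left (by norm_num)]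
    norm_num
  have hhalf : (1 / 2 : ℝ) ^ s ≤ 1 := Real.rpow_le_one (by norm_num) (by norm_num) hs0
  have hsum := wordSum_hitCount_le (ρ := 19 / 20) (by norm_num) (by norm_num) k m
  have hone : (1 / 2 : ℝ) ^ s * (2 - (1 - 19 / 20) * (1 / 2) ^ k) ≤ 1 := by
    have := one_half_rpow_mul_le_one (δ := 1 - s) (a := 2 - (1 - 19 / 20) * (1 / 2) ^ k)
      (by linarith) (by linarith)
    rwa [sub_sub_cancel] at this
  have hnn : 0 ≤ 2 - (1 - 19 / 20 : ℝ) * (1 / 2) ^ k := by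
    have : (1 / 2 : ℝ) ^ k ≤ 1 := pow_le_one₀ (by norm_num) (by norm_num)
    linarith
  calc _ ≤ wordSum (k + m) (fun w => 4 * ((1 / 2) ^ s) ^ (k + m) * (19 / 20) ^ hitCount k w) := by
        refine wordSum_mono _ fun w => ?_
        rw [Real.mul_rpow (by norm_num) (by positivity), Real.mul_rpow (by positivity)
          (by positivity), ← Real.rpow_natCast_mul (by norm_num), ← Real.rpow_natCast_mul
          (by norm_num), mul_comm (↑(k + m)) s, mul_comm (↑(hitCount k w)) s,
          Real.rpow_mul_natCast (by norm_num), Real.rpow_mul_natCast (by norm_num), ← mul_assoc]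
        gcongr
        exact Real.rpow_le_self_of_one_le (by norm_num) hs1
    _ = 4 * ((1 / 2) ^ s) ^ (k + m) * wordSum (k + m) (fun w => (19 / 20) ^ hitCount k w) :=
        wordSum_const_mul _ _ _
    _ ≤ 4 * ((1 / 2) ^ s) ^ (k + m) * (2 ^ k * (2 - (1 - 19 / 20) * (1 / 2) ^ k) ^ m) := by
        gcongr
    _ = 4 * 2 ^ k * (((1 / 2 : ℝ) ^ s) ^ k *
          ((1 / 2 : ℝ) ^ s * (2 - (1 - 19 / 20) * (1 / 2) ^ k)) ^ m) := by
        rw [mul_pow ((1 / 2 : ℝ) ^ s), pow_add]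
        ring
    _ ≤ 4 * 2 ^ k * (1 * 1) := by
        gcongr
        · exact pow_le_one₀ (by positivity) hhalf
        · exact pow_le_one₀ (mul_nonneg (by positivity) hnn) hone
    _ = _ := by ring

lemma hausdorffMeasure_Lambda_le {ε s : ℝ} (hε : 0 < ε) (hs : 1 / 2 ≤ s) (hs1 : s ≤ 1) {k : ℕ}
    (hkε : (1 / 4) ^ k ≤ ε) (hk : (1 - s) * 40 ≤ (1 / 2) ^ k) :
    Measure.hausdorffMeasure s (Lambda (fun x => 1 + ε - (2 + ε) * x ^ 2)) ≤
      ENNReal.ofReal (4 * 2 ^ k) := by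
  have hs0 : 0 ≤ s := by linarith
  have hdiam (m : ℕ) (w : Fin (k + m) → Bool) :
      Metric.ediam (wordMap ε (List.ofFn w) '' Icc (-1) 1) ≤
        ENNReal.ofReal (4 * ((1 / 2) ^ (k + m) * (9 / 10) ^ hitCount k (List.ofFn w))) := by
    refine Metric.ediam_le ?_
    rintro _ ⟨x, hx, rfl⟩ _ ⟨y, hy, rfl⟩
    rw [edist_dist]
    refine ENNReal.ofReal_le_ofReal ?_
    simpa using dist_wordMap_le hε hkε (List.ofFn w) hx hy
  refine (Measure.hausdorffMeasure_le_liminf_sum (ι := fun m => Fin (k + m) → Bool) s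
    (l := atTop) (Lambda (fun x => 1 + ε - (2 + ε) * x ^ 2))
    (fun m => ENNReal.ofReal (4 * (1 / 2) ^ (k + m))) ?_
    (fun m w => wordMap ε (List.ofFn w) '' Icc (-1) 1) ?_ ?_).trans ?_
  · rw [← ENNReal.ofReal_zero]
    refine ENNReal.tendsto_ofReal ?_
    have h := (tendsto_pow_atTop_nhds_zero_of_lt_one (r := (1 / 2 : ℝ)) (by norm_num)
      (by norm_num)).const_mul 4
    rw [mul_zero] at h
    exact h.comp (tendsto_add_atTop_nat k |>.congr fun m => add_comm m k)
  · refine Eventually.of_forall fun m w => (hdiam m w).trans (ENNReal.ofReal_le_ofReal ?_)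
    gcongr
    exact mul_le_of_le_one_right (by positivity) (pow_le_one₀ (by norm_num) (by norm_num))
  · refine Eventually.of_forall fun m x hx => ?_
    obtain ⟨w, hw, y, hy, rfl⟩ := exists_wordMap_eq hε.le (k + m) hx
    obtain ⟨v, rfl⟩ : ∃ v : Fin (k + m) → Bool, List.ofFn v = w := by
      rw [← hw]
      exact ⟨w.get, List.ofFn_get w⟩
    exact mem_iUnion.2 ⟨v, y, hy, rfl⟩
  · refine (liminf_le_liminf (v := fun _ => ENNReal.ofReal (4 * 2 ^ k))
      (Eventually.of_forall fun m => ?_)).trans (liminf_const _).le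
    calc _ ≤ ∑ w : Fin (k + m) → Bool, ENNReal.ofReal
          ((4 * ((1 / 2) ^ (k + m) * (9 / 10) ^ hitCount k (List.ofFn w))) ^ s) := by
          refine Finset.sum_le_sum fun w _ => ?_
          rw [← ENNReal.ofReal_rpow_of_nonneg (by positivity) hs0]
          gcongr
          exact hdiam m w
      _ ≤ _ := by
          rw [← ENNReal.ofReal_sum_of_nonneg fun _ _ => by positivity]
          exact ENNReal.ofReal_le_ofReal (wordSum_rpow_le hs hs1 hk m)

lemma dimH_Lambda_le {ε : ℝ} (hε : 0 < ε) (hε1 : ε ≤ 1) :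
    dimH (Lambda (fun x => 1 + ε - (2 + ε) * x ^ 2)) ≤ ENNReal.ofReal (1 - 1 / 80 * √ε) := by
  obtain ⟨k, -, hk, -, -, hk'⟩ := exists_scale hε hε1
  have h0 := Real.sqrt_nonneg ε
  have h1 : √ε ≤ 1 := Real.sqrt_le_one.2 hε1
  have hs : (0 : ℝ) ≤ 1 - 1 / 80 * √ε := by linarith
  refine dimH_le_of_hausdorffMeasure_ne_top (d := (1 - 1 / 80 * √ε).toNNReal) ?_
  rw [Real.coe_toNNReal _ hs]
  exact ((hausdorffMeasure_Lambda_le hε (by linarith) (by linarith) hk (by linarith)).trans_lt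
    ENNReal.ofReal_lt_top).ne

/-- An upper bound for `-log` of the excess at a point of the form `true :: w`, when `w` starts
with `j` times `false`. -/
noncomputable def runCost (ε : ℝ) (j : ℕ) : ℝ := 1 / 2 * Real.log (1 + ε * (4 + 2 * ε) ^ (1 + j))

/-- An upper bound for `-log (excess ε (wordMap ε w y))`. -/
noncomputable def stepCost (ε : ℝ) : List Bool → ℝ
  | [] => 3
  | false :: _ => ε / 2
  | true :: w => runCost ε (falseRun w)

/-- An upper bound for `-log (wordExcess ε w y)`. -/
noncomputable def cost (ε : ℝ) : List Bool → ℝ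
  | [] => 0
  | _ :: w => stepCost ε w + cost ε w

lemma div_le_one_add_invBranch_false {ε z : ℝ} (hε : 0 ≤ ε) (hz : z ≤ 1) :
    (1 + z) / (4 + 2 * ε) ≤ 1 + invBranch ε false z := by
  have h := quadratic_invBranch hε hz false
  rw [div_le_iff₀ (by linarith)]
  nlinarith [mul_nonneg (by linarith : 0 ≤ 2 + ε) (sq_nonneg (1 + invBranch ε false z))]

lemma inv_pow_falseRun_le {ε y : ℝ} (hε : 0 ≤ ε) (hy : y ∈ Icc 0 1) (w : List Bool) :
    1 / (4 + 2 * ε) ^ falseRun w ≤ 1 + wordMap ε w y := by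
  induction w with
  | nil => simpa [falseRun, wordMap] using hy.1
  | cons b w ih =>
    cases b
    · have hz := (wordMap_mem hε ⟨by linarith [hy.1], hy.2⟩ w).2
      refine le_trans ?_ (div_le_one_add_invBranch_false hε hz)
      rw [falseRun, pow_succ, ← div_div]
      gcongr
    · simp [falseRun, wordMap, invBranch]

lemma exp_neg_log_le_excess {ε z u : ℝ} (hu : 0 ≤ u) (hε : 0 ≤ ε) (hz : z < 1)
    (h : ε ≤ u * (1 - z)) : Real.exp (-(1 / 2 * Real.log (1 + u))) ≤ excess ε z := by
  refine Real.le_sqrt_of_sq_le ?_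
  rw [← Real.exp_nat_mul, Nat.cast_ofNat, show 2 * -(1 / 2 * Real.log (1 + u)) = -Real.log (1 + u)
    by ring, Real.exp_neg, Real.exp_log (by linarith), ← one_div,
    div_le_div_iff₀ (by linarith) (by linarith)]
  linarith

lemma half_log_one_add_le {u : ℝ} (hu : 0 ≤ u) : 1 / 2 * Real.log (1 + u) ≤ u / 2 := by
  linarith [Real.log_le_sub_one_of_pos (by linarith : 0 < 1 + u)]

lemma exp_neg_stepCost_le {ε y : ℝ} (hε : 0 < ε) (hε1 : ε ≤ 1) (hy : y ∈ Icc 0 (5 / 6)) :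
    ∀ w : List Bool, Real.exp (-stepCost ε w) ≤ excess ε (wordMap ε w y)
  | [] => by
    refine le_trans (Real.exp_le_exp.2 (neg_le_neg ?_)) (exp_neg_log_le_excess (u := 6 * ε)
      (by linarith) hε.le (by simp only [wordMap, id]; linarith [hy.2])
      (by simp only [wordMap, id]; nlinarith [hy.2]))
    exact (half_log_one_add_le (by linarith)).trans (by simp only [stepCost]; linarith)
  | false :: w => by
    have hz : wordMap ε (false :: w) y ≤ 0 := by
      simp [wordMap, invBranch]
    exact le_trans (Real.exp_le_exp.2 (neg_le_neg (half_log_one_add_le hε.le)))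
      (exp_neg_log_le_excess hε.le hε.le (by linarith) (by nlinarith))
  | true :: w => by
    have hy1 : y ∈ Icc 0 1 := ⟨hy.1, by linarith [hy.2]⟩
    have h1 := inv_pow_falseRun_le hε.le hy1 w
    have h2 := div_le_one_add_invBranch_false hε.le
      (wordMap_mem hε.le ⟨by linarith [hy.1], hy1.2⟩ w).2
    have h3 : 1 / (4 + 2 * ε) ^ (1 + falseRun w) ≤ 1 - wordMap ε (true :: w) y := by
      rw [add_comm 1, pow_succ, ← div_div]
      refine le_trans ?_ h2
      gcongr
    have h4 : 0 < (4 + 2 * ε) ^ (1 + falseRun w) := by positivity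
    have h5 : 0 < 1 / (4 + 2 * ε) ^ (1 + falseRun w) := by positivity
    refine exp_neg_log_le_excess (by positivity) hε.le (by linarith) ?_
    rw [div_le_iff₀ h4] at h3
    nlinarith

lemma exp_neg_cost_le {ε y : ℝ} (hε : 0 < ε) (hε1 : ε ≤ 1) (hy : y ∈ Icc 0 (5 / 6))
    (w : List Bool) : Real.exp (-cost ε w) ≤ wordExcess ε w y := by
  induction w with
  | nil => simp [cost, wordExcess]
  | cons b w ih =>
    rw [cost, neg_add, Real.exp_add]
    exact mul_le_mul (exp_neg_stepCost_le hε hε1 hy w) ih (Real.exp_nonneg _) (excess_nonneg _ _)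

lemma wordSum_add_falseRun_succ (n m : ℕ) (f : ℕ → ℝ) :
    wordSum (n + 1) (fun w => f (m + falseRun w)) =
      2 ^ n * f m + wordSum n (fun w => f (m + 1 + falseRun w)) := by
  rw [wordSum_succ, ← wordSum_const]
  simp only [falseRun, add_zero, add_assoc, add_comm 1]

lemma wordSum_falseRun_le_of_tail {f : ℕ → ℝ} {k : ℕ} (hf : ∀ i : ℕ, f (k + i) ≤ 2 + i) (n : ℕ) :
    ∀ i : ℕ, wordSum n (fun w => f (k + i + falseRun w)) ≤ 2 ^ n * (3 + i) := by
  induction n with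
  | zero =>
    intro i
    rw [wordSum_zero]
    simpa [falseRun] using (hf i).trans (by linarith)
  | succ n ih =>
    intro i
    have h1 := ih (i + 1)
    have h2 : 2 ^ n * f (k + i) ≤ 2 ^ n * (2 + i) := by gcongr; exact hf i
    rw [wordSum_add_falseRun_succ, pow_succ]
    rw [← add_assoc] at h1
    push_cast at h1
    linarith

lemma wordSum_falseRun_le {f : ℕ → ℝ} {a : ℝ} (ha : 0 ≤ a) {k : ℕ} (hf : ∀ j ≤ k, f j ≤ a * 4 ^ j)
    (hf' : ∀ i : ℕ, f (k + i) ≤ 2 + i) (n : ℕ) :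
    wordSum n (fun w => f (falseRun w)) ≤ 2 ^ n * (3 * (1 / 2) ^ k + 2 * a * 2 ^ k) := by
  have hsq (m : ℕ) : (4 : ℝ) ^ m = 2 ^ m * 2 ^ m := by rw [← mul_pow]; norm_num
  have hinv : (1 / 2 : ℝ) ^ k * 2 ^ k = 1 := by rw [← mul_pow]; norm_num
  have key (n : ℕ) : ∀ m ≤ k, wordSum n (fun w => f (m + falseRun w)) ≤
      2 ^ n * (2 ^ m * (3 * (1 / 2) ^ k + 2 * a * 2 ^ k) - a * 4 ^ m) := by
    induction n with
    | zero =>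
      intro m hm
      have h1 : (2 : ℝ) ^ m ≤ 2 ^ k := pow_le_pow_right₀ (by norm_num) hm
      have h2 : a * 4 ^ m ≤ a * (2 ^ m * 2 ^ k) := by rw [hsq]; gcongr
      have h3 : (0 : ℝ) ≤ 2 ^ m * (1 / 2) ^ k := by positivity
      simp only [wordSum_zero, falseRun, pow_zero, one_mul, add_zero]
      linarith [hf m hm]
    | succ n ih =>
      intro m hm
      rcases hm.eq_or_lt with rfl | hm
      · have h := wordSum_falseRun_le_of_tail hf' (n + 1) 0
        rw [Nat.cast_zero, add_zero] at h
        refine h.trans ?_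
        gcongr
        rw [hsq]
        nlinarith [mul_nonneg ha (by positivity : (0 : ℝ) ≤ 2 ^ m * 2 ^ m)]
      · have h1 := ih (m + 1) hm
        have h2 : 2 ^ n * f m ≤ 2 ^ n * (a * 4 ^ m) := by gcongr; exact hf m hm.le
        have h3 : 0 ≤ 2 ^ n * (a * 4 ^ m) := by positivity
        rw [wordSum_add_falseRun_succ]
        refine (add_le_add h2 h1).trans ?_
        rw [pow_succ 2 n, pow_succ 2 m, pow_succ 4 m]
        linarith
  have h := key n 0 k.zero_le
  simp only [zero_add, pow_zero, one_mul, mul_one] at h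
  refine h.trans ?_
  gcongr
  linarith

lemma pow_le_two_mul_four_pow {ε : ℝ} (hε : 0 < ε) {k : ℕ} (hk : 1 ≤ k)
    (hεk : ε ≤ 4 * (1 / 4) ^ k) {j : ℕ} (hj : j ≤ k) : (4 + 2 * ε) ^ j ≤ 2 * 4 ^ j := by
  have h1 : (k : ℝ) * 4 ≤ 4 ^ k := by
    obtain ⟨n, rfl⟩ := Nat.exists_eq_add_of_le' hk
    have := one_add_mul_le_pow (a := (3 : ℝ)) (by norm_num) n
    rw [pow_succ]
    push_cast
    norm_num at this
    nlinarith [n.cast_nonneg (α := ℝ)]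
  have h2 : (4 : ℝ) ^ k * (1 / 4) ^ k = 1 := by rw [← mul_pow]; norm_num
  have h3 : (j : ℝ) * ε ≤ 1 := by
    calc (j : ℝ) * ε ≤ k * (4 * (1 / 4) ^ k) := by gcongr
      _ ≤ 4 ^ k * (1 / 4) ^ k := by rw [← mul_assoc]; gcongr
      _ = 1 := h2
  have h4 : Real.exp (1 / 2) ≤ 2 := by
    rw [← Real.le_log_iff_exp_le two_pos]
    linarith [Real.log_two_gt_d9]
  calc (4 + 2 * ε) ^ j = (ε / 2 + 1) ^ j * 4 ^ j := by rw [← mul_pow]; ring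
    _ ≤ Real.exp (ε / 2) ^ j * 4 ^ j := by gcongr; exact Real.add_one_le_exp _
    _ = Real.exp (j * (ε / 2)) * 4 ^ j := by rw [Real.exp_nat_mul]
    _ ≤ Real.exp (1 / 2) * 4 ^ j := by gcongr; linarith
    _ ≤ _ := by gcongr

lemma runCost_le {ε : ℝ} (hε : 0 < ε) (hε1 : ε ≤ 1) {k : ℕ} (hk : 1 ≤ k)
    (hεk : ε ≤ 4 * (1 / 4) ^ k) {j : ℕ} (hj : j ≤ k) : runCost ε j ≤ 6 * ε * 4 ^ j := by
  refine (half_log_one_add_le (by positivity)).trans ?_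
  have h := pow_le_two_mul_four_pow hε hk hεk hj
  rw [pow_add, pow_one]
  calc ε * ((4 + 2 * ε) * (4 + 2 * ε) ^ j) / 2 ≤ ε * ((4 + 2 * 1) * (2 * 4 ^ j)) / 2 := by gcongr
    _ = _ := by ring

lemma runCost_add_le {ε : ℝ} (hε : 0 < ε) (hε1 : ε ≤ 1) {k : ℕ} (hk : 1 ≤ k)
    (hεk : ε ≤ 4 * (1 / 4) ^ k) (i : ℕ) : runCost ε (k + i) ≤ 2 + i := by
  have h1 := pow_le_two_mul_four_pow hε hk hεk le_rfl
  have h2 : (1 / 4 : ℝ) ^ k * 4 ^ k = 1 := by rw [← mul_pow]; norm_num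
  have h3 : (27 / 10 : ℝ) ≤ Real.exp 1 := by linarith [Real.exp_one_gt_d9]
  have h4 : (1 : ℝ) ≤ 6 ^ i := one_le_pow₀ (by norm_num)
  have h5 : 1 + ε * (4 + 2 * ε) ^ (1 + (k + i)) ≤ Real.exp (4 + 2 * i) := by
    calc 1 + ε * (4 + 2 * ε) ^ (1 + (k + i))
        = 1 + ε * (4 + 2 * ε) ^ k * ((4 + 2 * ε) * (4 + 2 * ε) ^ i) := by ring
      _ ≤ 1 + 4 * (1 / 4) ^ k * (2 * 4 ^ k) * ((4 + 2 * 1) * (4 + 2 * 1) ^ i) := by gcongr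
      _ = 1 + 48 * ((1 / 4 : ℝ) ^ k * 4 ^ k) * 6 ^ i := by ring
      _ ≤ (27 / 10) ^ 4 * 6 ^ i := by rw [h2]; linarith
      _ ≤ (27 / 10) ^ 4 * ((27 / 10) ^ 2) ^ i := by gcongr; norm_num
      _ ≤ Real.exp 1 ^ 4 * (Real.exp 1 ^ 2) ^ i := by gcongr
      _ = _ := by
        rw [← pow_mul, ← pow_add, ← Real.exp_nat_mul]
        push_cast
        ring_nf
  have h6 := Real.log_le_log (by positivity) h5
  rw [Real.log_exp] at h6
  rw [runCost]
  linarith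

lemma wordSum_runCost_le {ε : ℝ} (hε : 0 < ε) (hε1 : ε ≤ 1) (n : ℕ) :
    wordSum n (fun w => runCost ε (falseRun w)) ≤ 2 ^ n * (27 * √ε) := by
  obtain ⟨k, hk, -, hεk, hk1, hk2⟩ := exists_scale hε hε1
  refine (wordSum_falseRun_le (by positivity) (fun j hj => runCost_le hε hε1 hk hεk hj)
    (runCost_add_le hε hε1 hk hεk) n).trans ?_
  have h2 : (1 / 2 : ℝ) ^ k * 2 ^ k = 1 := by rw [← mul_pow]; norm_num
  have h3 : ε * 2 ^ k ≤ 2 * √ε := by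
    calc ε * 2 ^ k = √ε * √ε * 2 ^ k := by rw [Real.mul_self_sqrt hε.le]
      _ ≤ √ε * (2 * (1 / 2) ^ k) * 2 ^ k := by gcongr
      _ = 2 * √ε * ((1 / 2) ^ k * 2 ^ k) := by ring
      _ = 2 * √ε := by rw [h2, mul_one]
  gcongr
  linarith

lemma wordSum_stepCost_le {ε : ℝ} (hε : 0 < ε) (hε1 : ε ≤ 1) (n : ℕ) :
    wordSum (n + 1) (stepCost ε) ≤ 2 ^ (n + 1) * (15 * √ε) := by
  have h1 := wordSum_runCost_le hε hε1 n
  have h2 : ε ≤ √ε := Real.le_sqrt_of_sq_le (by nlinarith)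
  have h3 : wordSum n (fun _ => ε / 2) ≤ 2 ^ n * (√ε / 2) := by rw [wordSum_const]; gcongr
  have h4 : 0 ≤ 2 ^ n * √ε := by positivity
  rw [wordSum_succ, pow_succ]
  simp only [stepCost]
  linarith

lemma wordSum_cost_le {ε : ℝ} (hε : 0 < ε) (hε1 : ε ≤ 1) (n : ℕ) :
    wordSum n (cost ε) ≤ 2 ^ n * (15 * √ε * n + 3) := by
  induction n with
  | zero => simp [wordSum_zero, cost]
  | succ n ih =>
    rw [wordSum_succ]
    simp only [cost]
    rw [wordSum_add]
    cases n with
    | zero =>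
      simp only [wordSum_zero, stepCost, cost]
      norm_num
      linarith [Real.sqrt_nonneg ε]
    | succ n =>
      have h := wordSum_stepCost_le hε hε1 n
      rw [pow_succ 2 (n + 1), Nat.cast_add_one (n + 1)]
      linarith

lemma wordSum_cost_true_true_le {ε : ℝ} (hε : 0 < ε) (hε1 : ε ≤ 1) (n : ℕ) :
    wordSum (n + 1) (fun w => cost ε (true :: true :: w)) ≤
      2 ^ (n + 1) * (15 * √ε * (n + 1 : ℕ) + 45) := by
  have h1 := wordSum_runCost_le hε hε1 (n + 1)
  have h2 := wordSum_stepCost_le hε hε1 n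
  have h3 := wordSum_cost_le hε hε1 (n + 1)
  have h4 : 2 ^ (n + 1) * √ε ≤ 2 ^ (n + 1) * 1 := by gcongr; exact Real.sqrt_le_one.2 hε1
  change wordSum (n + 1) (fun w => runCost ε (falseRun w) + (stepCost ε w + cost ε w)) ≤ _
  rw [wordSum_add, wordSum_add]
  linarith

lemma le_dist_wordMap {ε : ℝ} (hε : 0 < ε) (hε1 : ε ≤ 1) (w : List Bool)
    (hw : ∀ c ∈ Icc (0 : ℝ) (5 / 6), wordMap ε w c ^ 2 ≤ 3 / 4) {x y : ℝ}
    (hx : x ∈ Icc 0 (5 / 6)) (hy : y ∈ Icc 0 (5 / 6)) :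
    (1 / 2) ^ (w.length + 1) * Real.exp (-cost ε w) * dist x y ≤
      dist (wordMap ε w x) (wordMap ε w y) := by
  wlog hxy : x < y generalizing x y
  · rcases (not_lt.1 hxy).eq_or_lt with h | h
    · simp [h]
    · rw [dist_comm, dist_comm (wordMap ε w x)]
      exact this hy hx h
  have hmem : ∀ c ∈ Ioo x y, c ∈ Ioo (-1) 1 := fun c hc =>
    ⟨by linarith [hx.1, hc.1], by linarith [hy.2, hc.2]⟩
  obtain ⟨c, hc, heq⟩ := exists_deriv_eq_slope (wordMap ε w) hxy
    (continuous_wordMap ε w).continuousOn fun c hc => by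
      obtain ⟨D, hD, -⟩ := exists_hasDerivAt_wordMap hε (hmem c hc) w
      exact hD.differentiableAt.differentiableWithinAt
  have hc' : c ∈ Icc 0 (5 / 6) := ⟨hx.1.trans hc.1.le, hc.2.le.trans hy.2⟩
  obtain ⟨D, hD, hDabs⟩ := exists_hasDerivAt_wordMap hε (hmem c hc) w
  rw [hD.deriv, eq_div_iff (by linarith)] at heq
  have h1 : √(1 - c ^ 2) ≤ 1 := Real.sqrt_le_one.2 (by nlinarith [sq_nonneg c])
  have h2 : 1 / 2 ≤ √(1 - wordMap ε w c ^ 2) :=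
    Real.le_sqrt_of_sq_le (by linarith [hw c hc'])
  have h3 := exp_neg_cost_le hε hε1 hc' w
  rw [dist_comm, dist_comm (wordMap ε w x), Real.dist_eq (wordMap ε w y), ← heq, abs_mul,
    ← Real.dist_eq]
  gcongr
  calc (1 / 2) ^ (w.length + 1) * Real.exp (-cost ε w)
      = (1 / 2) ^ w.length * Real.exp (-cost ε w) * (1 / 2) := by ring
    _ ≤ (1 / 2) ^ w.length * wordExcess ε w c * √(1 - wordMap ε w c ^ 2) := by
        have := wordExcess_nonneg ε c w
        gcongr
    _ = |D| * √(1 - c ^ 2) := hDabs.symm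
    _ ≤ |D| := mul_le_of_le_one_right (abs_nonneg _) h1

lemma two_pow_mul_exp_le_wordSum {n : ℕ} {f : List Bool → ℝ} {μ s : ℝ} (hs : 0 ≤ s)
    (h : wordSum n f ≤ 2 ^ n * μ) :
    2 ^ n * Real.exp (-(s * μ)) ≤ wordSum n (fun w => Real.exp (-(s * f w))) := by
  have hexp (w : List Bool) : Real.exp (-(s * μ)) * (1 + s * μ) + -(s * Real.exp (-(s * μ))) * f w ≤
      Real.exp (-(s * f w)) := by
    calc _ = Real.exp (-(s * μ)) * ((s * μ - s * f w) + 1) := by ring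
      _ ≤ Real.exp (-(s * μ)) * Real.exp (s * μ - s * f w) := by
          gcongr
          exact Real.add_one_le_exp _
      _ = _ := by
          rw [← Real.exp_add]
          ring_nf
  refine le_trans ?_ (wordSum_mono n hexp)
  rw [wordSum_add, wordSum_const, wordSum_const_mul]
  nlinarith [mul_le_mul_of_nonneg_left h (mul_nonneg hs (Real.exp_nonneg (-(s * μ))))]

lemma exists_one_le_wordSum_rpow {ε : ℝ} (hε : 0 < ε) (hε1 : ε ≤ 1) (hs : 0 ≤ 1 - 30 * √ε) :
    ∃ n : ℕ, 1 ≤ wordSum (n + 1) (fun w =>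
      ((1 / 2) ^ (n + 4) * Real.exp (-cost ε (true :: true :: w))) ^ (1 - 30 * √ε)) := by
  have h0 : 0 < √ε := Real.sqrt_pos.2 hε
  obtain ⟨n, hn⟩ := exists_nat_gt (48 / (5 * √ε))
  rw [div_lt_iff₀ (by positivity)] at hn
  refine ⟨n, ?_⟩
  have h1 := two_pow_mul_exp_le_wordSum hs (wordSum_cost_true_true_le hε hε1 n)
  set s := 1 - 30 * √ε with hs_def
  set μ := 15 * √ε * (n + 1 : ℕ) + 45 with hμ
  have h2 : (fun w => ((1 / 2) ^ (n + 4) * Real.exp (-cost ε (true :: true :: w))) ^ s) =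
      fun w => Real.exp (-((n + 4) * s * Real.log 2)) *
        Real.exp (-(s * cost ε (true :: true :: w))) := by
    funext w
    rw [Real.mul_rpow (by positivity) (by positivity), ← Real.exp_mul, ← Real.rpow_natCast_mul
      (by norm_num), Real.rpow_def_of_pos (by norm_num), one_div, Real.log_inv]
    push_cast
    ring_nf
  have h3 : (2 : ℝ) ^ (n + 1) = Real.exp ((n + 1) * Real.log 2) := by
    rw [← Nat.cast_add_one, Real.exp_nat_mul, Real.exp_log two_pos]
  rw [h2, wordSum_const_mul]
  refine le_trans ?_ (mul_le_mul_of_nonneg_left h1 (Real.exp_nonneg _))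
  rw [h3, ← Real.exp_add, ← Real.exp_add, Real.one_le_exp_iff]
  have h4 := Real.log_two_gt_d9
  have h5 := Real.log_two_lt_d9
  have h6 : s * μ ≤ μ := mul_le_of_le_one_left (by positivity) (by linarith)
  have h7 : (n + 1) * √ε * 20 ≤ (n + 1) * √ε * (30 * Real.log 2) := by gcongr; linarith
  have h8 : s * Real.log 2 ≤ 1 := by nlinarith
  have h9 : (n + 4) * s * Real.log 2 =
      (n + 1) * Real.log 2 - (n + 1) * √ε * (30 * Real.log 2) + 3 * (s * Real.log 2) := by
    rw [hs_def]
    ring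
  have h10 : μ = 15 * ((n + 1) * √ε) + 45 := by
    rw [hμ]
    push_cast
    ring
  rw [h9]
  linarith

lemma invBranch_true_mem {ε y : ℝ} (hε : 0 ≤ ε) (hε1 : ε ≤ 1) (hy : 0 ≤ y) :
    invBranch ε true y ∈ Icc 0 (5 / 6) := by
  refine ⟨Real.sqrt_nonneg _, (Real.sqrt_le_left (by norm_num)).2 ?_⟩
  rw [div_le_iff₀ (by linarith)]
  linarith

lemma wordMap_true_true_mem {ε : ℝ} (hε : 0 ≤ ε) (hε1 : ε ≤ 1) (w : List Bool) (y : ℝ) :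
    wordMap ε (true :: true :: w) y ∈ Icc 0 (5 / 6) :=
  invBranch_true_mem hε hε1 (Real.sqrt_nonneg _)

lemma fixedPoint_mem_Lambda {ε : ℝ} (hε : 0 ≤ ε) :
    (1 + ε) / (2 + ε) ∈ Lambda (fun x => 1 + ε - (2 + ε) * x ^ 2) := by
  intro n
  have hfix : Function.IsFixedPt (fun x => 1 + ε - (2 + ε) * x ^ 2) ((1 + ε) / (2 + ε)) := by
    have : 2 + ε ≠ 0 := by linarith
    simp only [Function.IsFixedPt]
    field_simp
    ring
  rw [(hfix.iterate n).eq]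
  have : 0 ≤ (1 + ε) / (2 + ε) := by positivity
  exact ⟨by linarith, (div_le_one (by linarith)).2 (by linarith)⟩

lemma le_dimH_Lambda {ε : ℝ} (hε : 0 < ε) (hε1 : ε ≤ 1) :
    ENNReal.ofReal (1 - 30 * √ε) ≤ dimH (Lambda (fun x => 1 + ε - (2 + ε) * x ^ 2)) := by
  rcases le_or_gt (1 - 30 * √ε) 0 with hs | hs
  · rw [ENNReal.ofReal_of_nonpos hs]
    exact zero_le
  obtain ⟨n, hn⟩ := exists_one_le_wordSum_rpow hε hε1 hs.le
  set Λ := Lambda (fun x => 1 + ε - (2 + ε) * x ^ 2)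
  have hIcc : ∀ x ∈ Λ ∩ Icc 0 (5 / 6), x ∈ Icc (-1) 1 := fun x hx => hx.1 0
  refine le_trans ?_ (dimH_mono (inter_subset_left (s := Λ) (t := Icc 0 (5 / 6))))
  refine le_dimH_of_separated_maps (ι := Fin (n + 1) → Bool)
    (g := fun w => wordMap ε (true :: true :: List.ofFn w))
    (r := fun w => (1 / 2) ^ (n + 4) * Real.exp (-cost ε (true :: true :: List.ofFn w)))
    ((isCompact_Lambda ε).inter_right isClosed_Icc)
    ⟨(1 + ε) / (2 + ε), fixedPoint_mem_Lambda hε.le, by positivity, ?_⟩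
    (fun w x hx => ⟨wordMap_mem_Lambda hε.le hx.1 _, wordMap_true_true_mem hε.le hε1 _ _⟩)
    (fun w => continuous_wordMap ε _) (fun v w hvw x hx y hy h => hvw ?_)
    (fun w => by positivity) (fun w x hx y hy => ?_) hs hn
  · rw [div_le_iff₀ (by linarith)]
    linarith
  · have h' := eq_of_wordMap_eq hε (hIcc x hx) (hIcc y hy) (by simp) h
    exact List.ofFn_injective (List.cons.inj (List.cons.inj h').2).2
  · have h := le_dist_wordMap hε hε1 (true :: true :: List.ofFn w) (fun c _ => by
      have h := wordMap_true_true_mem hε.le hε1 (List.ofFn w) c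
      nlinarith [h.1, h.2]) hx.2 hy.2
    simpa using h

lemma dimH_Lambda_zero : dimH (Lambda (fun x => 1 + 0 - (2 + 0) * x ^ 2)) = 1 := by
  have h : Icc (-1) 1 ⊆ Lambda (fun x => 1 + 0 - (2 + 0) * x ^ 2) := fun x hx n =>
    MapsTo.iterate (fun x (hx : x ∈ Icc (-1) 1) => by
      constructor <;> nlinarith [hx.1, hx.2]) n hx
  rw [Real.dimH_of_mem_nhds (x := 0) (mem_of_superset (Icc_mem_nhds (by norm_num) (by norm_num)) h)]
  simp

/-- Proposition 3: for `q_ε(x) = 1 + ε - (2+ε)x²`, the Hausdorff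
dimension of the maximal invariant set `Λ_ε` satisfies
`1 - C⁻¹√ε ≤ HD(ε) ≤ 1 - C√ε` for all `0 ≤ ε ≤ 1`, with `C > 0` independent of `ε`. -/
theorem hausdorff_dimension_quadratic_family :
    ∃ C > (0:ℝ), ∀ ε ∈ Icc (0:ℝ) 1,
      ENNReal.ofReal (1 - C⁻¹ * Real.sqrt ε) ≤
        dimH (Lambda (fun x => 1 + ε - (2 + ε) * x ^ 2)) ∧
      dimH (Lambda (fun x => 1 + ε - (2 + ε) * x ^ 2)) ≤
        ENNReal.ofReal (1 - C * Real.sqrt ε) := by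
  refine ⟨1 / 80, by norm_num, fun ε hε => ?_⟩
  rcases hε.1.eq_or_lt with rfl | hpos
  · rw [dimH_Lambda_zero]
    simp
  · refine ⟨le_trans (ENNReal.ofReal_le_ofReal ?_) (le_dimH_Lambda hpos hε.2),
      dimH_Lambda_le hpos hε.2⟩
    norm_num
    linarith [Real.sqrt_nonneg ε]
end

section
/- Let {F_ε}_{0≤ε≤ε₀} be a family of C³ embeddings of [-1,0] with nonpositive Schwarzian derivative such that each F_ε fixes −1 and maps 0 to 1+ε, F_ε'(−1) > 1/γ for a fixed γ > 1, and (x,ε) ↦ F_ε(x) is C² jointly; set f_ε(x) = F_ε(−|x|^γ), and let η_{n,ε} be the partitions determined by f_ε. Then there is a constant C > 0, not depending on ε, such that for every 0 ≤ ε ≤ ε₀, every n ≥ 0, and every pair (J, I) with J ∈ η_{n+1,ε}, I ∈ η_{n,ε} and J ⊂ I, one has |J|/|I| ≥ C. -/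
open Set MeasureTheory Filter Topology

/-- A nonpositive Schwarzian derivative bounds the geometric mean of the derivatives at two points
by the slope between them. -/
theorem sq_mul_deriv_le_of_schwarzian {h h₁ h₂ h₃ : ℝ → ℝ} {a b : ℝ} (hab : a ≤ b)
    (hd1 : ∀ x ∈ Icc a b, HasDerivWithinAt h (h₁ x) (Icc a b) x)
    (hd2 : ∀ x ∈ Icc a b, HasDerivWithinAt h₁ (h₂ x) (Icc a b) x)
    (hd3 : ∀ x ∈ Icc a b, HasDerivWithinAt h₂ (h₃ x) (Icc a b) x)
    (hpos : ∀ x ∈ Icc a b, 0 < h₁ x)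
    (hS : ∀ x ∈ Icc a b, h₃ x * h₁ x ≤ 3 / 2 * h₂ x ^ 2) :
    (b - a) ^ 2 * (h₁ a * h₁ b) ≤ (h b - h a) ^ 2 := by
  set r : ℝ → ℝ := fun t => √(h₁ t) with hr
  set v : ℝ → ℝ := fun t => (r t)⁻¹ with hv
  have hrpos : ∀ x ∈ Icc a b, 0 < r x := fun x hx => Real.sqrt_pos.2 (hpos x hx)
  have hrsq : ∀ x ∈ Icc a b, r x ^ 2 = h₁ x := fun x hx => Real.sq_sqrt (hpos x hx).le
  have hrd : ∀ x ∈ Icc a b, HasDerivWithinAt r (h₂ x / (2 * r x)) (Icc a b) x := fun x hx =>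
    (hd2 x hx).sqrt (hpos x hx).ne'
  have hvd : ∀ x ∈ Icc a b, HasDerivWithinAt v (-(1 / 2) * h₂ x * v x ^ 3) (Icc a b) x := by
    intro x hx
    have := (hrd x hx).inv (hrpos x hx).ne'
    refine this.congr_deriv ?_
    have := (hrpos x hx).ne'
    simp only [hv]
    field_simp
  have hamem : a ∈ Icc a b := left_mem_Icc.2 hab
  have hbmem : b ∈ Icc a b := right_mem_Icc.2 hab
  have hint : interior (Icc a b) ⊆ Icc a b := interior_subset
  have hE : MonotoneOn (fun t => v a - v t + (t - a) * (-(1 / 2) * h₂ t * v t ^ 3)) (Icc a b) := by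
    have hder : ∀ x ∈ Icc a b, HasDerivWithinAt
        (fun t => v a - v t + (t - a) * (-(1 / 2) * h₂ t * v t ^ 3))
        ((x - a) * v x ^ 5 * (3 / 4 * h₂ x ^ 2 - 1 / 2 * (h₃ x * h₁ x))) (Icc a b) x := by
      intro x hx
      have h1 := ((hd3 x hx).const_mul (-(1 / 2))).mul ((hvd x hx).pow 3)
      have h2 := ((hvd x hx).const_sub (v a)).add
        (((hasDerivWithinAt_id x (Icc a b)).sub_const a).mul h1)
      refine h2.congr_deriv ?_
      have h3 : h₁ x * v x ^ 2 = 1 := by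
        rw [← hrsq x hx]
        simp only [hv]
        have := (hrpos x hx).ne'
        field_simp
      simp
      linear_combination (1 / 2) * (x - a) * h₃ x * v x ^ 3 * h3
    refine monotoneOn_of_hasDerivWithinAt_nonneg (convex_Icc a b)
      (fun x hx => (hder x hx).continuousWithinAt)
      (fun x hx => (hder x (hint hx)).mono hint) fun x hx => ?_
    have hx' := hint hx
    have := inv_pos.2 (hrpos x hx')
    have := hS x hx'
    exact mul_nonneg (mul_nonneg (sub_nonneg.2 hx'.1) (by positivity)) (by linarith)
  have hW : MonotoneOn (fun t => h t - h a - (t - a) * (r a * r t)) (Icc a b) := by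
    have hder : ∀ x ∈ Icc a b, HasDerivWithinAt (fun t => h t - h a - (t - a) * (r a * r t))
        (r a * r x ^ 2 * (v a - v x + (x - a) * (-(1 / 2) * h₂ x * v x ^ 3))) (Icc a b) x := by
      intro x hx
      have h2 := ((hd1 x hx).sub_const (h a)).sub
        (((hasDerivWithinAt_id x (Icc a b)).sub_const a).mul ((hrd x hx).const_mul (r a)))
      refine h2.congr_deriv ?_
      have := (hrpos x hx).ne'
      have := (hrpos a hamem).ne'
      rw [← hrsq x hx]
      simp only [hv, id]
      field_simp
      ring
    refine monotoneOn_of_hasDerivWithinAt_nonneg (convex_Icc a b)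
      (fun x hx => (hder x hx).continuousWithinAt)
      (fun x hx => (hder x (hint hx)).mono hint) fun x hx => ?_
    have hx' := hint hx
    have h0 := hE hamem hx' hx'.1
    simp only [sub_self, zero_mul, add_zero] at h0
    have := hrpos a hamem
    have := hrpos x hx'
    exact mul_nonneg (by positivity) h0
  have key := hW hamem hbmem hab
  simp only [sub_self, zero_mul] at key
  have h1 := hrpos a hamem
  have h2 := hrpos b hbmem
  rw [← hrsq a hamem, ← hrsq b hbmem]
  have h3 : 0 ≤ (b - a) * (r a * r b) := mul_nonneg (sub_nonneg.2 hab) (by positivity)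
  calc (b - a) ^ 2 * (r a ^ 2 * r b ^ 2) = ((b - a) * (r a * r b)) ^ 2 := by ring
    _ ≤ _ := pow_le_pow_left₀ h3 (by linarith) 2

theorem sq_mul_deriv_rpow_le {γ : ℝ} (hγ : 1 < γ) {x y : ℝ} (hx : 0 ≤ x) (hxy : x ≤ y) :
    (y - x) ^ 2 * ((γ * x ^ (γ - 1)) * (γ * y ^ (γ - 1))) ≤ (y ^ γ - x ^ γ) ^ 2 := by
  rcases hx.eq_or_lt with rfl | hx
  · rw [Real.zero_rpow (by linarith : γ - 1 ≠ 0)]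
    simp only [mul_zero, zero_mul]
    positivity
  have hpos : ∀ t ∈ Icc x y, 0 < t := fun t ht => hx.trans_le ht.1
  refine sq_mul_deriv_le_of_schwarzian (h := fun t => t ^ γ) (h₁ := fun t => γ * t ^ (γ - 1))
    (h₂ := fun t => γ * ((γ - 1) * t ^ (γ - 1 - 1)))
    (h₃ := fun t => γ * ((γ - 1) * ((γ - 1 - 1) * t ^ (γ - 1 - 1 - 1)))) hxy
    (fun t ht => (Real.hasDerivAt_rpow_const (Or.inl (hpos t ht).ne')).hasDerivWithinAt)
    (fun t ht => ((Real.hasDerivAt_rpow_const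
      (Or.inl (hpos t ht).ne')).const_mul γ).hasDerivWithinAt)
    (fun t ht => (((Real.hasDerivAt_rpow_const
      (Or.inl (hpos t ht).ne')).const_mul (γ - 1)).const_mul γ).hasDerivWithinAt)
    (fun t ht => by have := Real.rpow_pos_of_pos (hpos t ht) (γ - 1); positivity) fun t ht => ?_
  have ht0 := hpos t ht
  have e1 : t ^ (γ - 1 - 1 - 1) * t ^ (γ - 1) = t ^ (γ - 1 - 1) * t ^ (γ - 1 - 1) := by
    rw [← Real.rpow_add ht0, ← Real.rpow_add ht0]
    ring_nf
  have e2 : 0 < t ^ (γ - 1 - 1) := Real.rpow_pos_of_pos ht0 _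
  have e3 : 0 ≤ γ ^ 2 * (γ - 1) * (γ + 1) * (t ^ (γ - 1 - 1)) ^ 2 := by
    have : 0 < γ - 1 := by linarith
    positivity
  have e4 : γ * ((γ - 1) * ((γ - 1 - 1) * t ^ (γ - 1 - 1 - 1))) * (γ * t ^ (γ - 1))
      = γ ^ 2 * (γ - 1) * (γ - 2) * (t ^ (γ - 1 - 1)) ^ 2 := by
    linear_combination γ ^ 2 * (γ - 1) * (γ - 2) * e1
  simp only [e4]
  nlinarith [e3]

/-- A function whose derivatives satisfy the geometric-mean bound expands cross-ratios. -/
theorem cross_ratio_le_of_sq_mul_deriv_le {h h' : ℝ → ℝ} {l u : ℝ}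
    (hd : ∀ x ∈ Icc l u, HasDerivWithinAt h (h' x) (Icc l u) x)
    (hmono : StrictMonoOn h (Icc l u))
    (hN : ∀ x ∈ Icc l u, ∀ y ∈ Icc l u, x ≤ y → (y - x) ^ 2 * (h' x * h' y) ≤ (h y - h x) ^ 2)
    {a b c d : ℝ} (ha : l ≤ a) (hab : a < b) (hbc : b < c) (hcd : c < d) (hdu : d ≤ u) :
    (h c - h a) * (h d - h b) * ((d - a) * (c - b)) ≤
      (h d - h a) * (h c - h b) * ((d - b) * (c - a)) := by
  have hk : ∀ t ∈ Ioo c d, h' t / (h t - h b) - 1 / (t - b) ≤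
      h' t / (h t - h a) - 1 / (t - a) := by
    intro t ht
    have htm : t ∈ Icc l u := ⟨by linarith [ht.1], by linarith [ht.2]⟩
    have hsub : Icc a b ⊆ Icc l u := Icc_subset_Icc ha (by linarith)
    have hne : ∀ x ∈ Icc a b, 0 < h t - h x := fun x hx =>
      sub_pos.2 (hmono (hsub hx) htm (by linarith [hx.2, ht.1]))
    have hne' : ∀ x ∈ Icc a b, 0 < t - x := fun x hx => by linarith [hx.2, ht.1]
    have hder : ∀ x ∈ Icc a b, HasDerivWithinAt (fun x => h' t / (h t - h x) - 1 / (t - x))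
        (h' t * h' x / (h t - h x) ^ 2 - 1 / (t - x) ^ 2) (Icc a b) x := by
      intro x hx
      have h1 := ((hasDerivWithinAt_const x (Icc a b) (h' t)).div
        (((hd x (hsub hx)).mono hsub).const_sub (h t)) (hne x hx).ne').sub
        ((hasDerivWithinAt_const x (Icc a b) (1 : ℝ)).div
        ((hasDerivWithinAt_id x (Icc a b)).const_sub t) (hne' x hx).ne')
      refine h1.congr_deriv ?_
      simp
    have hanti : AntitoneOn (fun x => h' t / (h t - h x) - 1 / (t - x)) (Icc a b) := by
      refine antitoneOn_of_hasDerivWithinAt_nonpos (convex_Icc a b)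
        (fun x hx => (hder x hx).continuousWithinAt)
        (fun x hx => (hder x (interior_subset hx)).mono interior_subset) fun x hx => ?_
      have hx := interior_subset hx
      have h1 := hne x hx
      have h2 := hne' x hx
      rw [sub_nonpos, div_le_div_iff₀ (by positivity) (by positivity)]
      linarith [hN x (hsub hx) t htm (by linarith)]
    exact hanti (left_mem_Icc.2 hab.le) (right_mem_Icc.2 hab.le) hab.le
  have hsub : Icc c d ⊆ Icc l u := Icc_subset_Icc (by linarith) hdu
  have ham : a ∈ Icc l u := ⟨ha, by linarith⟩
  have hbm : b ∈ Icc l u := ⟨by linarith, by linarith⟩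
  have pa : ∀ x ∈ Icc c d, 0 < h x - h a := fun x hx =>
    sub_pos.2 (hmono ham (hsub hx) (by linarith [hx.1]))
  have pb : ∀ x ∈ Icc c d, 0 < h x - h b := fun x hx =>
    sub_pos.2 (hmono hbm (hsub hx) (by linarith [hx.1]))
  have qa : ∀ x ∈ Icc c d, 0 < x - a := fun x hx => by linarith [hx.1]
  have qb : ∀ x ∈ Icc c d, 0 < x - b := fun x hx => by linarith [hx.1]
  have hH : MonotoneOn (fun t => Real.log (h t - h a) - Real.log (t - a)
      - (Real.log (h t - h b) - Real.log (t - b))) (Icc c d) := by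
    have hder : ∀ x ∈ Icc c d, HasDerivWithinAt (fun t => Real.log (h t - h a) - Real.log (t - a)
      - (Real.log (h t - h b) - Real.log (t - b)))
        (h' x / (h x - h a) - 1 / (x - a) - (h' x / (h x - h b) - 1 / (x - b))) (Icc c d) x := by
      intro x hx
      have h0 := (hd x (hsub hx)).mono hsub
      have hi := hasDerivWithinAt_id x (Icc c d)
      exact (((h0.sub_const (h a)).log (pa x hx).ne').sub
        ((hi.sub_const a).log (qa x hx).ne')).sub
        (((h0.sub_const (h b)).log (pb x hx).ne').sub ((hi.sub_const b).log (qb x hx).ne'))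
    refine monotoneOn_of_hasDerivWithinAt_nonneg (convex_Icc c d)
      (fun x hx => (hder x hx).continuousWithinAt)
      (fun x hx => (hder x (interior_subset hx)).mono interior_subset) fun x hx => ?_
    rw [interior_Icc] at hx
    exact sub_nonneg.2 (hk x hx)
  have hcm := left_mem_Icc.2 hcd.le
  have hdm := right_mem_Icc.2 hcd.le
  have key := hH hcm hdm hcd.le
  simp only at key
  have a1 := pa c hcm
  have a2 := pa d hdm
  have a3 := pb c hcm
  have a4 := pb d hdm
  have b1 := qa c hcm
  have b2 := qa d hdm
  have b3 := qb c hcm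
  have b4 := qb d hdm
  rw [← Real.log_le_log_iff (by positivity) (by positivity)]
  rw [Real.log_mul (by positivity) (by positivity), Real.log_mul (by positivity) (by positivity),
    Real.log_mul (by positivity) (by positivity), Real.log_mul (by positivity) (by positivity),
    Real.log_mul (by positivity) (by positivity), Real.log_mul (by positivity) (by positivity)]
  linarith

/-- Maps of `[-1, 1]` onto an interval, strictly monotone, that do not increase cross-ratios
(the finite version of a nonnegative Schwarzian derivative). -/
structure CrossRatioContracting (g : ℝ → ℝ) : Prop where
  mono : StrictMonoOn g (Icc (-1) 1) ∨ StrictAntiOn g (Icc (-1) 1)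
  maps : MapsTo g (Icc (-1) 1) (Icc (-1) 1)
  image : ∀ a ∈ Icc (-1 : ℝ) 1, ∀ b ∈ Icc (-1 : ℝ) 1, g '' uIcc a b = uIcc (g a) (g b)
  cross : ∀ a b c d : ℝ, -1 ≤ a → a < b → b < c → c < d → d ≤ 1 →
    |g a - g d| * |g b - g c| * ((d - b) * (c - a)) ≤
      |g b - g d| * |g a - g c| * ((d - a) * (c - b))

namespace CrossRatioContracting

variable {g h : ℝ → ℝ}

theorem injOn (hg : CrossRatioContracting g) : InjOn g (Icc (-1) 1) :=
  hg.mono.elim StrictMonoOn.injOn StrictAntiOn.injOn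

theorem abs_add (hg : CrossRatioContracting g) {x y z : ℝ} (hx : -1 ≤ x) (hxy : x ≤ y)
    (hyz : y ≤ z) (hz : z ≤ 1) : |g x - g z| = |g x - g y| + |g y - g z| := by
  have hx' : x ∈ Icc (-1 : ℝ) 1 := ⟨hx, by linarith⟩
  have hy' : y ∈ Icc (-1 : ℝ) 1 := ⟨by linarith, by linarith⟩
  have hz' : z ∈ Icc (-1 : ℝ) 1 := ⟨by linarith, hz⟩
  rcases hg.mono with hm | hm
  · have h1 := hm.monotoneOn hx' hy' hxy
    have h2 := hm.monotoneOn hy' hz' hyz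
    rw [abs_of_nonpos (by linarith), abs_of_nonpos (by linarith), abs_of_nonpos (by linarith)]
    ring
  · have h1 := hm.antitoneOn hx' hy' hxy
    have h2 := hm.antitoneOn hy' hz' hyz
    rw [abs_of_nonneg (by linarith), abs_of_nonneg (by linarith), abs_of_nonneg (by linarith)]
    ring

theorem id : CrossRatioContracting id where
  mono := Or.inl (strictMono_id.strictMonoOn _)
  maps := mapsTo_id _
  image a _ b _ := by simp
  cross a b c d _ hab hbc hcd _ := by
    simp only [id_eq]
    rw [abs_of_neg (by linarith), abs_of_neg (by linarith), abs_of_neg (by linarith),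
      abs_of_neg (by linarith)]
    apply le_of_eq
    ring

theorem neg : CrossRatioContracting (fun x => -x) where
  mono := Or.inr fun _ _ _ _ hxy => neg_lt_neg hxy
  maps x hx := ⟨by linarith [hx.2], by linarith [hx.1]⟩
  image a _ b _ := by simp
  cross a b c d _ hab hbc hcd _ := by
    rw [abs_of_pos (by linarith), abs_of_pos (by linarith), abs_of_pos (by linarith),
      abs_of_pos (by linarith)]
    apply le_of_eq
    ring

theorem congr (hg : CrossRatioContracting g) (hh : EqOn h g (Icc (-1) 1)) :
    CrossRatioContracting h where
  mono := hg.mono.imp (fun H => H.congr hh.symm) fun H => H.congr hh.symm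
  maps := hg.maps.congr hh.symm
  image a ha b hb := by
    rw [hh ha, hh hb, ← hg.image a ha b hb]
    exact image_congr fun x hx => hh ((convex_Icc (-1 : ℝ) 1).ordConnected.uIcc_subset ha hb hx)
  cross a b c d ha hab hbc hcd hd := by
    rw [hh (x := a) ⟨ha, by linarith⟩, hh (x := b) ⟨by linarith, by linarith⟩,
      hh (x := c) ⟨by linarith, by linarith⟩, hh (x := d) ⟨by linarith, hd⟩]
    exact hg.cross a b c d ha hab hbc hcd hd

theorem comp (hg : CrossRatioContracting g) (hh : CrossRatioContracting h) :
    CrossRatioContracting (g ∘ h) where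
  mono := by
    rcases hg.mono with H | H <;> rcases hh.mono with H' | H'
    · exact Or.inl (H.comp H' hh.maps)
    · exact Or.inr (H.comp_strictAntiOn H' hh.maps)
    · exact Or.inr (H.comp_strictMonoOn H' hh.maps)
    · exact Or.inl (H.comp H' hh.maps)
  maps := hg.maps.comp hh.maps
  image a ha b hb := by
    rw [image_comp, hh.image a ha b hb, hg.image _ (hh.maps ha) _ (hh.maps hb)]
    rfl
  cross a b c d ha hab hbc hcd hd := by
    have aux : ∀ {X Y p q u w : ℝ}, X * p ≤ Y * q → q * u ≤ p * w → 0 < p → 0 ≤ u → 0 ≤ Y →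
        X * u ≤ Y * w := by
      intro X Y p q u w h1 h2 hp hu hY
      have h3 := mul_le_mul_of_nonneg_right h1 hu
      have h4 := mul_le_mul_of_nonneg_left h2 hY
      nlinarith
    have ha' : a ∈ Icc (-1 : ℝ) 1 := ⟨ha, by linarith⟩
    have hb' : b ∈ Icc (-1 : ℝ) 1 := ⟨by linarith, by linarith⟩
    have hc' : c ∈ Icc (-1 : ℝ) 1 := ⟨by linarith, by linarith⟩
    have hd' : d ∈ Icc (-1 : ℝ) 1 := ⟨by linarith, hd⟩
    have h2 := hh.cross a b c d ha hab hbc hcd hd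
    have hu : 0 ≤ (d - b) * (c - a) := mul_nonneg (by linarith) (by linarith)
    simp only [Function.comp]
    rcases hh.mono with H | H
    · have e1 := H ha' hb' hab
      have e2 := H hb' hc' hbc
      have e3 := H hc' hd' hcd
      have h1 := hg.cross _ _ _ _ (hh.maps ha').1 e1 e2 e3 (hh.maps hd').2
      rw [abs_of_neg (by linarith), abs_of_neg (by linarith), abs_of_neg (by linarith),
        abs_of_neg (by linarith)] at h2
      refine aux h1 ?_ (mul_pos (by linarith) (by linarith)) hu (by positivity)
      linarith
    · have e1 := H ha' hb' hab
      have e2 := H hb' hc' hbc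
      have e3 := H hc' hd' hcd
      have h1 := hg.cross _ _ _ _ (hh.maps hd').1 e3 e2 e1 (hh.maps ha').2
      rw [abs_of_pos (by linarith), abs_of_pos (by linarith), abs_of_pos (by linarith),
        abs_of_pos (by linarith)] at h2
      rw [abs_sub_comm (g (h d)) (g (h a)), abs_sub_comm (g (h c)) (g (h b)),
        abs_sub_comm (g (h c)) (g (h a)), abs_sub_comm (g (h d)) (g (h b))] at h1
      rw [mul_comm |g (h b) - g (h d)|]
      refine aux h1 ?_ (mul_pos (a := h a - h c) (b := h b - h d) (by linarith) (by linarith))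
        hu (by positivity)
      linarith

/-- One-sided Koebe distortion: with room on the left, an interval is stretched at most as much,
up to a constant, as its right neighbour. -/
theorem koebe (hg : CrossRatioContracting g) {b c d : ℝ} (hb : -1 < b) (hbc : b ≤ c)
    (hcd : c ≤ d) (hd : d ≤ 1) :
    |g b - g c| * ((d - c) * (b + 1)) ≤ |g c - g d| * (2 * (c - b)) := by
  rcases hbc.eq_or_lt with rfl | hbc
  · simp
  rcases hcd.eq_or_lt with rfl | hcd
  · simp
  have h1 := hg.cross (-1) b c d le_rfl hb hbc hcd hd
  rw [hg.abs_add (x := -1) (y := b) (z := d) le_rfl hb.le (by linarith) hd,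
    hg.abs_add (x := b) (y := c) (z := d) hb.le hbc.le hcd.le hd,
    hg.abs_add (x := -1) (y := b) (z := c) le_rfl hb.le hbc.le (by linarith)] at h1
  have hl : 0 < |g (-1) - g b| := abs_pos.2 <| sub_ne_zero.2 fun h =>
    hb.ne (hg.injOn ⟨le_rfl, by norm_num⟩ ⟨hb.le, by linarith⟩ h)
  have hj := abs_nonneg (g b - g c)
  have hr := abs_nonneg (g c - g d)
  generalize |g (-1) - g b| = l at *
  generalize |g b - g c| = j at *
  generalize |g c - g d| = r at *
  have h2 : (l + j + r) * j * ((b + 1) * (d - c)) ≤ l * r * ((d + 1) * (c - b)) := by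
    linear_combination h1
  have h3 : l * (j * ((d - c) * (b + 1))) ≤ l * (r * (2 * (c - b))) := by
    have h4 : 0 ≤ (j + r) * j * ((b + 1) * (d - c)) :=
      mul_nonneg (by positivity) (mul_nonneg (by linarith) (by linarith))
    have h5 : 0 ≤ l * r * ((1 - d) * (c - b)) :=
      mul_nonneg (by positivity) (mul_nonneg (by linarith) (by linarith))
    linarith
  exact le_of_mul_le_mul_left h3 hl

end CrossRatioContracting

/-- Quantitative description of the nonnegative inverse branch `p` of a map such as
`x ↦ F (-|x| ^ γ)`. -/
structure BranchBounds (p : ℝ → ℝ) (c L κ s D : ℝ) : Prop where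
  cr : CrossRatioContracting p
  anti : StrictAntiOn p (Icc (-1) 1)
  nonneg : ∀ x ∈ Icc (-1 : ℝ) 1, 0 ≤ p x
  map_neg_one : p (-1) = 1
  lower : ∀ x ∈ Icc (-1 : ℝ) 1, ∀ y ∈ Icc (-1 : ℝ) 1, x ≤ y → c * (y - x) ≤ p x - p y
  upper : ∀ y ∈ Icc (-1 : ℝ) 1, 1 - p y ≤ L * (y + 1)
  contract : ∀ y ∈ Icc (-1) s, 1 - p y ≤ (1 - κ) * (y + 1)
  right_end : ∀ x y : ℝ, -1 ≤ x → x ≤ y → y < 1 → 1 - y ≤ L / (κ * c) * (y - x) →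
    p y - p 1 ≤ D * (p x - p y)

theorem gw_append (f : ℝ → ℝ) (w v : List Bool) : gw f (w ++ v) = gw f w ∘ gw f v := by
  induction w with
  | nil => rfl
  | cons b w ih => rw [List.cons_append, gw, gw, ih]; rfl

theorem gw_concat (f : ℝ → ℝ) (w : List Bool) (b : Bool) :
    gw f (w ++ [b]) = gw f w ∘ branch f b := gw_append f w [b]

namespace BranchBounds

variable {f p : ℝ → ℝ} {c L κ s D : ℝ}

theorem branch_cr (hp : BranchBounds p c L κ s D)
    (ht : EqOn (branch f true) p (Icc (-1) 1))
    (hf : EqOn (branch f false) (fun x => -p x) (Icc (-1) 1)) (b : Bool) :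
    CrossRatioContracting (branch f b) := by
  cases b
  · exact (CrossRatioContracting.neg.comp hp.cr).congr hf
  · exact hp.cr.congr ht

theorem gw_cr (hp : BranchBounds p c L κ s D)
    (ht : EqOn (branch f true) p (Icc (-1) 1))
    (hf : EqOn (branch f false) (fun x => -p x) (Icc (-1) 1)) (w : List Bool) :
    CrossRatioContracting (gw f w) := by
  induction w with
  | nil => exact CrossRatioContracting.id
  | cons b w ih => exact (hp.branch_cr ht hf b).comp ih

theorem exists_gw_eq (hp : BranchBounds p c L κ s D)
    (ht : EqOn (branch f true) p (Icc (-1) 1))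
    (hf : EqOn (branch f false) (fun x => -p x) (Icc (-1) 1)) {w : List Bool} (hw : w ≠ []) :
    ∃ G, CrossRatioContracting G ∧ ∀ x ∈ Icc (-1 : ℝ) 1, gw f w x = G (p x) := by
  obtain ⟨v, b, rfl⟩ := (List.eq_nil_or_concat w).resolve_left hw
  have hv := hp.gw_cr ht hf v
  cases b
  · exact ⟨_, hv.comp CrossRatioContracting.neg, fun x hx => by
      simp [gw_concat, hf hx]⟩
  · exact ⟨_, hv, fun x hx => by simp [gw_concat, ht hx]⟩

theorem right_piece_le (hp : BranchBounds p c L κ s D)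
    (ht : EqOn (branch f true) p (Icc (-1) 1))
    (hf : EqOn (branch f false) (fun x => -p x) (Icc (-1) 1)) {w : List Bool} (hw : w ≠ [])
    {x : ℝ} (hx : x ∈ Icc (-1 : ℝ) 1) :
    |gw f w x - gw f w 1| * (1 - p x) ≤ 2 * |gw f w (-1) - gw f w x| := by
  obtain ⟨G, hG, hGe⟩ := hp.exists_gw_eq ht hf hw
  have h1 : (1 : ℝ) ∈ Icc (-1 : ℝ) 1 := by simp
  have h2 : (-1 : ℝ) ∈ Icc (-1 : ℝ) 1 := by simp
  rw [hGe x hx, hGe 1 h1, hGe (-1) h2, hp.map_neg_one, abs_sub_comm, abs_sub_comm (G 1)]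
  have h3 := hp.nonneg 1 h1
  have h4 := hp.anti.antitoneOn hx h1 hx.2
  have h5 := (hp.cr.maps hx).2
  have h6 := hG.koebe (by linarith) h4 h5 le_rfl
  have h7 := abs_nonneg (G (p 1) - G (p x))
  have h8 := abs_nonneg (G (p x) - G 1)
  have h9 : 0 ≤ |G (p 1) - G (p x)| * (1 - p x) := mul_nonneg h7 (by linarith)
  nlinarith

theorem left_piece_le (hp : BranchBounds p c L κ s D) (hc : 0 < c) (hL : 0 < L) (hκ : 0 < κ)
    (hκ1 : κ < 1) (hs : s ≤ 0) (hD : 0 < D)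
    (ht : EqOn (branch f true) p (Icc (-1) 1))
    (hf : EqOn (branch f false) (fun x => -p x) (Icc (-1) 1)) (w : List Bool) :
    ∀ y ∈ Ioc (-1) s, |gw f w (-1) - gw f w (-p y)| ≤
      (1 / κ + L / (κ * c) + 2 * D) * |gw f w (-p y) - gw f w y| := by
  have h1 : (1 : ℝ) ∈ Icc (-1 : ℝ) 1 := by simp
  have h2 : (-1 : ℝ) ∈ Icc (-1 : ℝ) 1 := by simp
  have hA : 0 < L / (κ * c) := by positivity
  have hκ' : 0 < 1 / κ := by positivity
  induction w using List.reverseRecOn with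
  | nil =>
    intro y hy
    have hy' : y ∈ Icc (-1 : ℝ) 1 := ⟨hy.1.le, by linarith [hy.2]⟩
    have h3 := hp.contract y ⟨hy.1.le, hy.2⟩
    have h4 := (hp.cr.maps hy').2
    have h5 : 0 ≤ y + 1 := by linarith [hy.1]
    have h6 : κ * (y + 1) ≤ y + p y := by linarith
    have h7 : 0 ≤ y + p y := le_trans (by positivity) h6
    simp only [gw, id]
    rw [abs_of_nonpos (by linarith), abs_of_nonpos (by linarith)]
    have h8 : 1 - p y ≤ 1 / κ * (y + p y) := by
      rw [div_mul_eq_mul_div, one_mul, le_div_iff₀ hκ]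
      nlinarith
    nlinarith
  | append_singleton v b ih =>
    intro y hy
    have hy' : y ∈ Icc (-1 : ℝ) 1 := ⟨hy.1.le, by linarith [hy.2]⟩
    have h3 := hp.contract y ⟨hy.1.le, hy.2⟩
    have h4 := (hp.cr.maps hy').2
    have h40 := hp.nonneg y hy'
    have h5 : 0 < y + 1 := by linarith [hy.1]
    have h6 : κ * (y + 1) ≤ y + p y := by linarith
    have h7 : 0 < y + p y := lt_of_lt_of_le (by positivity) h6
    have hz' : -p y ∈ Icc (-1 : ℝ) 1 := ⟨by linarith, by linarith⟩
    have hpy1 : p y < 1 := by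
      have := hp.anti h2 hy' hy.1
      rwa [hp.map_neg_one] at this
    cases b
    · have h8 := ih (-p y) ⟨by linarith, by linarith [hy.2]⟩
      simp only [gw_concat, Function.comp, hf h2, hf hz', hf hy', hp.map_neg_one]
      exact h8
    · simp only [gw_concat, Function.comp, ht h2, ht hz', ht hy', hp.map_neg_one]
      have hm := hp.cr.maps hz'
      have hl := hp.lower _ hz' _ hy' (by linarith)
      have hu := hp.upper _ hz'
      have hB : 1 - p (-p y) ≤ L / (κ * c) * (p (-p y) - p y) := by
        rw [div_mul_eq_mul_div, le_div_iff₀ (by positivity)]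
        have e1 : 1 - p y ≤ y + 1 := by nlinarith
        have e2 : κ * c * (1 - p (-p y)) ≤ κ * c * (L * (-p y + 1)) :=
          mul_le_mul_of_nonneg_left hu (by positivity)
        have e3 : κ * (-p y + 1) ≤ y + p y := le_trans (by nlinarith) h6
        have e4 : c * L * (κ * (-p y + 1)) ≤ c * L * (y + p y) :=
          mul_le_mul_of_nonneg_left e3 (by positivity)
        nlinarith
      have hpz := hp.anti.antitoneOn hz' hy' (by linarith)
      rcases eq_or_ne v [] with rfl | hv
      · simp only [gw, id]
        rw [abs_of_nonneg (by linarith [hm.2]), abs_of_nonneg (by linarith)]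
        nlinarith
      · obtain ⟨G, hG, hGe⟩ := hp.exists_gw_eq ht hf hv
        have hpym := hp.cr.maps hy'
        rw [hGe 1 h1, hGe _ hm, hGe _ hpym]
        have hz1 : p (-p y) < 1 := by
          have := hp.anti h2 hz' (by linarith)
          rwa [hp.map_neg_one] at this
        have hr := hp.right_end (p y) (p (-p y)) (by linarith) hpz hz1 hB
        have e1 := hp.anti hm h1 hz1
        have e2 := hp.anti hpym hm (hp.anti hz' hy' (by linarith))
        have e3 := hp.nonneg 1 h1
        have k := hG.koebe (by linarith) e1.le e2.le (hp.cr.maps hpym).2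
        generalize |G (p 1) - G (p (p (-p y)))| = j at *
        have hrr := abs_nonneg (G (p (p (-p y))) - G (p (p y)))
        generalize |G (p (p (-p y))) - G (p (p y))| = r at *
        have e4 : 0 < p (p y) - p (p (-p y)) := by linarith
        have e5 : j ≤ 2 * D * r := by
          by_contra! hcon
          have q1 : 2 * D * r * ((p (p y) - p (p (-p y))) * (p 1 + 1)) <
            j * ((p (p y) - p (p (-p y))) * (p 1 + 1)) :=
            mul_lt_mul_of_pos_right hcon (mul_pos e4 (by linarith))
          have q2 := mul_le_mul_of_nonneg_left hr (by linarith : 0 ≤ 2 * r)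
          have q3 : 0 ≤ D * r * ((p (p y) - p (p (-p y))) * p 1) := by positivity
          linarith
        nlinarith

/-- Bounded geometry of the words, with a constant depending only on the branch bounds. -/
theorem exists_pos_mul_le (hc : 0 < c) (hL : 0 < L) (hκ : 0 < κ)
    (hκ1 : κ < 1) (hs : s ≤ 0) (hs1 : -1 < s) (hD : 0 < D) :
    ∃ C > (0 : ℝ), ∀ f p : ℝ → ℝ, BranchBounds p c L κ s D →
      EqOn (branch f true) p (Icc (-1) 1) →
      EqOn (branch f false) (fun x => -p x) (Icc (-1) 1) → ∀ w ≠ [], ∀ b : Bool,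
      |gw f w (-1) - gw f w 1| ≤
        C * |gw f (w ++ [b]) (-1) - gw f (w ++ [b]) 1| := by
  have hs' : 0 < s + 1 := by linarith
  set C₁ : ℝ := 1 + 2 / (c * (c * (s + 1))) with hC₁
  set C₂ : ℝ := 1 / κ + L / (κ * c) + 2 * D with hC₂
  set C₃ : ℝ := 4 / (2 * c * (c * (s + 1))) with hC₃
  have p1 : 0 < C₁ := by positivity
  have p2 : 0 < C₂ := by positivity
  have p3 : 0 < C₃ := by positivity
  refine ⟨(1 + 2 / (c * (2 * c))) + C₁ * ((C₂ + 1) * C₃), by positivity, ?_⟩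
  intro f p hp ht hf w hw b
  have h1 : (1 : ℝ) ∈ Icc (-1 : ℝ) 1 := by simp
  have h2 : (-1 : ℝ) ∈ Icc (-1 : ℝ) 1 := by simp
  have hcr := hp.gw_cr ht hf w
  have h10 := hp.nonneg 1 h1
  have h11 := hp.lower (-1) h2 1 h1 (by norm_num)
  rw [hp.map_neg_one] at h11
  have main : ∀ x ∈ Icc (-1 : ℝ) 1, ∀ η > 0, η ≤ x + 1 →
      |gw f w (-1) - gw f w 1| ≤ (1 + 2 / (c * η)) * |gw f w (-1) - gw f w x| := by
    intro x hx η hη hηx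
    rw [hcr.abs_add le_rfl hx.1 hx.2 le_rfl]
    have e1 := hp.right_piece_le ht hf hw hx
    have e2 := hp.lower (-1) h2 x hx hx.1
    rw [hp.map_neg_one] at e2
    have e3 : c * η ≤ 1 - p x := le_trans (by nlinarith) e2
    have e4 := mul_le_mul_of_nonneg_left e3 (abs_nonneg (gw f w x - gw f w 1))
    have e5 : |gw f w x - gw f w 1| ≤ 2 / (c * η) * |gw f w (-1) - gw f w x| := by
      rw [div_mul_eq_mul_div, le_div_iff₀ (by positivity)]
      exact e4.trans e1
    linarith
  simp only [gw_concat, Function.comp]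
  cases b
  · rw [hf h2, hf h1]
    beta_reduce
    rw [hp.map_neg_one]
    refine (main (-p 1) ⟨by linarith [(hp.cr.maps h1).2], by linarith⟩ (2 * c)
      (by positivity) (by linarith)).trans ?_
    exact mul_le_mul_of_nonneg_right (le_add_of_nonneg_right (by positivity)) (abs_nonneg _)
  · rw [ht h2, ht h1, hp.map_neg_one, abs_sub_comm (gw f w 1)]
    have hsm : s ∈ Icc (-1 : ℝ) 1 := ⟨hs1.le, by linarith⟩
    have hps := hp.cr.maps hsm
    have hps1 := hp.anti hsm h1 (by linarith)
    have hlow := hp.lower (-1) h2 s hsm hs1.le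
    rw [hp.map_neg_one] at hlow
    have hcon := hp.contract s ⟨hs1.le, le_rfl⟩
    have hzs : -p s ≤ s := by nlinarith
    have hcs : 0 < c * (s + 1) := by positivity
    have e1 := main (-p s) ⟨by linarith [hps.2], by linarith⟩ (c * (s + 1)) (by positivity)
      (by linarith)
    have e2 := hp.left_piece_le hc hL hκ hκ1 hs hD ht hf w s ⟨hs1, le_rfl⟩
    have e3 := hcr.abs_add (x := -p s) (y := s) (z := p 1) (by linarith) hzs (by linarith)
      (by linarith)
    have e4 := hcr.koebe (b := -p s) (c := p 1) (d := 1) (by linarith) (by linarith)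
      (by linarith) le_rfl
    have a1 := abs_nonneg (gw f w (p 1) - gw f w 1)
    have a2 := abs_nonneg (gw f w s - gw f w (p 1))
    have a3 := abs_nonneg (gw f w (-p s) - gw f w (p 1))
    have e5 : |gw f w (-p s) - gw f w (p 1)| ≤ C₃ * |gw f w (p 1) - gw f w 1| := by
      rw [hC₃, div_mul_eq_mul_div, le_div_iff₀ (by positivity)]
      have q1 : 2 * c * (c * (s + 1)) ≤ (1 - p 1) * (-p s + 1) :=
        mul_le_mul (by linarith) (by linarith) hcs.le (by linarith)
      have q2 := mul_le_mul_of_nonneg_left q1 a3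
      have q3 : 2 * (p 1 - -p s) ≤ 4 := by linarith [hps.2, (hp.cr.maps h1).2]
      have q4 := mul_le_mul_of_nonneg_left q3 a1
      linarith
    calc |gw f w (-1) - gw f w 1| ≤ C₁ * |gw f w (-1) - gw f w (-p s)| := e1
      _ ≤ C₁ * (C₂ * |gw f w (-p s) - gw f w s|) := mul_le_mul_of_nonneg_left e2 p1.le
      _ ≤ C₁ * ((C₂ + 1) * (C₃ * |gw f w (p 1) - gw f w 1|)) := by
        refine mul_le_mul_of_nonneg_left ?_ p1.le
        refine mul_le_mul (by linarith) (by linarith) (abs_nonneg _) (by linarith)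
      _ ≤ _ := by
        have : 0 ≤ (1 + 2 / (c * (2 * c))) * |gw f w (p 1) - gw f w 1| := by positivity
        linarith


theorem inter_subsingleton (hp : BranchBounds p c L κ s D)
    (ht : EqOn (branch f true) p (Icc (-1) 1))
    (hf : EqOn (branch f false) (fun x => -p x) (Icc (-1) 1)) (v : List Bool) :
    ∀ u : List Bool, v.length = u.length → v ≠ u → (Iw f v ∩ Iw f u).Subsingleton := by
  induction v with
  | nil =>
    intro u hlen hne
    exact absurd (List.length_eq_zero_iff.1 hlen.symm).symm hne
  | cons b v ih =>
    intro u hlen hne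
    cases u with
    | nil => simp at hlen
    | cons b' u =>
      have hsub : ∀ w, Iw f w ⊆ Icc (-1) 1 := fun w => (hp.gw_cr ht hf w).maps.image_subset
      have hcons : ∀ b w, Iw f (b :: w) = branch f b '' Iw f w := fun b w => by
        rw [Iw, Iw, gw, image_comp]
      have htrue : ∀ w, Iw f (true :: w) ⊆ Ici 0 := by
        rintro w _ ⟨x, hx, rfl⟩
        have := (hp.gw_cr ht hf w).maps hx
        simpa [gw, ht this] using hp.nonneg _ this
      have hfalse : ∀ w, Iw f (false :: w) ⊆ Iic 0 := by
        rintro w _ ⟨x, hx, rfl⟩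
        have := (hp.gw_cr ht hf w).maps hx
        simpa [gw, hf this] using hp.nonneg _ this
      by_cases hb : b = b'
      · subst hb
        rw [hcons, hcons, ← (hp.branch_cr ht hf b).injOn.image_inter (hsub v) (hsub u)]
        exact (ih u (by simpa using hlen) (by simpa using hne)).image _
      · have : Iw f (b :: v) ∩ Iw f (b' :: u) ⊆ {0} := by
          rintro x ⟨hx, hx'⟩
          cases b <;> cases b'
          · exact absurd rfl hb
          · exact le_antisymm (hfalse v hx) (htrue u hx')
          · exact le_antisymm (hfalse u hx') (htrue v hx)
          · exact absurd rfl hb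
        exact subsingleton_singleton.anti this

theorem exists_eq_concat_of_subset (hp : BranchBounds p c L κ s D)
    (ht : EqOn (branch f true) p (Icc (-1) 1))
    (hf : EqOn (branch f false) (fun x => -p x) (Icc (-1) 1)) {w v : List Bool}
    (hlen : v.length = w.length + 1) (hsub : Iw f v ⊆ Iw f w) : ∃ b, v = w ++ [b] := by
  obtain ⟨u, b, rfl⟩ := (List.eq_nil_or_concat v).resolve_left (by rintro rfl; simp at hlen)
  have hu : u.length = w.length := by simpa using hlen
  rw [List.concat_eq_append] at hsub ⊢
  refine ⟨b, ?_⟩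
  by_contra hne
  have hss := hp.inter_subsingleton ht hf u w hu fun h => hne (by rw [h])
  have h1 : Iw f (u ++ [b]) ⊆ Iw f u := by
    rw [Iw, gw_concat, image_comp]
    exact image_mono (hp.branch_cr ht hf b).maps.image_subset
  have h2 : (1 : ℝ) ∈ Icc (-1 : ℝ) 1 := by simp
  have h3 : (-1 : ℝ) ∈ Icc (-1 : ℝ) 1 := by simp
  have h4 := (hss.anti (subset_inter h1 hsub)) (mem_image_of_mem _ h2) (mem_image_of_mem _ h3)
  have h5 := (hp.gw_cr ht hf (u ++ [b])).injOn h2 h3 h4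
  norm_num at h5

theorem len_Iw (hp : BranchBounds p c L κ s D)
    (ht : EqOn (branch f true) p (Icc (-1) 1))
    (hf : EqOn (branch f false) (fun x => -p x) (Icc (-1) 1)) (w : List Bool) :
    len (Iw f w) = |gw f w (-1) - gw f w 1| := by
  have h := (hp.gw_cr ht hf w).image (-1) (by simp) 1 (by simp)
  rw [uIcc_of_le (by norm_num)] at h
  rw [len, Iw, h, uIcc, Real.volume_Icc, max_sub_min_eq_abs,
    ENNReal.toReal_ofReal (abs_nonneg _), abs_sub_comm]

end BranchBounds


theorem mul_sub_le_of_le_deriv {h h' : ℝ → ℝ} {a b k : ℝ} (hab : a ≤ b)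
    (hd : ∀ x ∈ Icc a b, HasDerivWithinAt h (h' x) (Icc a b) x)
    (hk : ∀ x ∈ Icc a b, k ≤ h' x) : k * (b - a) ≤ h b - h a := by
  have hm : MonotoneOn (fun x => h x - k * x) (Icc a b) := by
    have hder : ∀ x ∈ Icc a b, HasDerivWithinAt (fun x => h x - k * x) (h' x - k) (Icc a b) x :=
      fun x hx => ((hd x hx).sub ((hasDerivWithinAt_id x _).const_mul k)).congr_deriv (by simp)
    exact monotoneOn_of_hasDerivWithinAt_nonneg (convex_Icc a b)
      (fun x hx => (hder x hx).continuousWithinAt)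
      (fun x hx => (hder x (interior_subset hx)).mono interior_subset)
      fun x hx => sub_nonneg.2 (hk x (interior_subset hx))
  have := hm (left_mem_Icc.2 hab) (right_mem_Icc.2 hab) hab
  simp only at this
  linarith

theorem sub_le_mul_of_deriv_le {h h' : ℝ → ℝ} {a b k : ℝ} (hab : a ≤ b)
    (hd : ∀ x ∈ Icc a b, HasDerivWithinAt h (h' x) (Icc a b) x)
    (hk : ∀ x ∈ Icc a b, h' x ≤ k) : h b - h a ≤ k * (b - a) := by
  have := mul_sub_le_of_le_deriv (h := fun x => -h x) (h' := fun x => -h' x) (k := -k) hab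
    (fun x hx => (hd x hx).neg) fun x hx => neg_le_neg (hk x hx)
  linarith

theorem rpow_sub_rpow_le {γ x y : ℝ} (hγ : 1 ≤ γ) (hx : 0 ≤ x) (hxy : x ≤ y) :
    y ^ γ - x ^ γ ≤ γ * y ^ (γ - 1) * (y - x) :=
  sub_le_mul_of_deriv_le (h := fun t => t ^ γ) hxy
    (fun _ _ => (Real.hasDerivAt_rpow_const (Or.inr hγ)).hasDerivWithinAt) fun t ht =>
    mul_le_mul_of_nonneg_left (Real.rpow_le_rpow (hx.trans ht.1) ht.2 (by linarith))
      (by linarith)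

theorem le_rpow_sub_rpow {γ x y : ℝ} (hγ : 1 ≤ γ) (hx : 0 ≤ x) (hxy : x ≤ y) :
    γ * x ^ (γ - 1) * (y - x) ≤ y ^ γ - x ^ γ :=
  mul_sub_le_of_le_deriv (h := fun t => t ^ γ) hxy
    (fun _ _ => (Real.hasDerivAt_rpow_const (Or.inr hγ)).hasDerivWithinAt) fun t ht =>
    mul_le_mul_of_nonneg_left (Real.rpow_le_rpow hx ht.1 (by linarith)) (by linarith)

theorem rpow_sub_one_mul_sub_le {γ x y : ℝ} (hγ : 1 < γ) (hx : 0 ≤ x) (hxy : x ≤ y) :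
    y ^ (γ - 1) * (y - x) ≤ y ^ γ - x ^ γ := by
  have e : ∀ t : ℝ, 0 ≤ t → t ^ γ = t ^ (γ - 1) * t := fun t ht => by
    conv_lhs => rw [show γ = (γ - 1) + 1 by ring]
    rw [Real.rpow_add_one' ht (by linarith)]
  rw [e x hx, e y (hx.trans hxy)]
  have := mul_le_mul_of_nonneg_right (Real.rpow_le_rpow hx hxy (by linarith : 0 ≤ γ - 1)) hx
  linarith

theorem branchBounds_of_schwarzian {γ e m M m₁ x₀ κ : ℝ} {F F₁ F₂ F₃ : ℝ → ℝ} (hγ : 1 < γ)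
    (he : 0 ≤ e)
    (hd1 : ∀ x ∈ Icc (-1 : ℝ) 0, HasDerivWithinAt F (F₁ x) (Icc (-1) 0) x)
    (hd2 : ∀ x ∈ Icc (-1 : ℝ) 0, HasDerivWithinAt F₁ (F₂ x) (Icc (-1) 0) x)
    (hd3 : ∀ x ∈ Icc (-1 : ℝ) 0, HasDerivWithinAt F₂ (F₃ x) (Icc (-1) 0) x)
    (hS : ∀ x ∈ Icc (-1 : ℝ) 0, F₃ x * F₁ x ≤ 3 / 2 * F₂ x ^ 2)
    (hm : 0 < m) (hm1 : m ≤ 1) (hF1 : ∀ x ∈ Icc (-1 : ℝ) 0, m ≤ F₁ x ∧ F₁ x ≤ M)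
    (hfix : F (-1) = -1) (hF0 : F 0 = 1 + e)
    (hm₁ : 0 < m₁) (hx₀ : x₀ ∈ Ioo (0 : ℝ) 1) (hF1' : ∀ x ∈ Icc (-1) (-x₀ ^ γ), m₁ ≤ F₁ x)
    (hκ1 : κ < 1) (hκ : 1 ≤ (1 - κ) * (m₁ * (γ * x₀ ^ (γ - 1)))) :
    BranchBounds (branch (fun x => F (-(|x| ^ γ))) true) (1 / (γ * M)) (1 / m) κ
      (-1 + m * (1 - x₀))
      (1 + 1 / m / (κ * (1 / (γ * M))) * M * (γ * 2 ^ (γ - 1)) / m) ∧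
    EqOn (branch (fun x => F (-(|x| ^ γ))) false)
      (fun x => -branch (fun x => F (-(|x| ^ γ))) true x) (Icc (-1) 1) := by
  set f : ℝ → ℝ := fun x => F (-(|x| ^ γ)) with hf
  set p := branch f true with hp
  have hγ0 : 0 < γ := by linarith
  have hM : 0 < M := hm.trans_le
    ((hF1 0 (by simp)).1.trans (hF1 0 (by simp)).2)
  have hFm : ∀ a b, -1 ≤ a → a ≤ b → b ≤ 0 → m * (b - a) ≤ F b - F a := fun a b ha hab hb =>
    have hs : Icc a b ⊆ Icc (-1) 0 := Icc_subset_Icc ha hb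
    mul_sub_le_of_le_deriv hab (fun x hx => (hd1 x (hs hx)).mono hs) fun x hx => (hF1 x (hs hx)).1
  have hFM : ∀ a b, -1 ≤ a → a ≤ b → b ≤ 0 → F b - F a ≤ M * (b - a) := fun a b ha hab hb =>
    have hs : Icc a b ⊆ Icc (-1) 0 := Icc_subset_Icc ha hb
    sub_le_mul_of_deriv_le hab (fun x hx => (hd1 x (hs hx)).mono hs) fun x hx => (hF1 x (hs hx)).2
  have hfeq : ∀ x, 0 ≤ x → f x = F (-(x ^ γ)) := fun x hx => by rw [hf]; simp [abs_of_nonneg hx]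
  have heven : ∀ x, f (-x) = f x := fun x => by rw [hf]; simp
  have hpow : ∀ x ∈ Icc (0 : ℝ) 1, -(x ^ γ) ∈ Icc (-1 : ℝ) 0 := fun x hx =>
    ⟨neg_le_neg (Real.rpow_le_one hx.1 hx.2 hγ0.le), neg_nonpos.2 (Real.rpow_nonneg hx.1 _)⟩
  have hud : ∀ x ∈ Icc (0 : ℝ) 1, HasDerivWithinAt (fun t => -F (-(t ^ γ)))
      (F₁ (-(x ^ γ)) * (γ * x ^ (γ - 1))) (Icc 0 1) x := by
    intro x hx
    have h1 : HasDerivWithinAt (fun t : ℝ => -(t ^ γ)) (-(γ * x ^ (γ - 1))) (Icc 0 1) x :=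
      (Real.hasDerivAt_rpow_const (Or.inr hγ.le)).hasDerivWithinAt.neg
    have h2 := ((hd1 _ (hpow x hx)).comp x h1 hpow).neg
    refine h2.congr_deriv ?_
    ring
  have hpowm : ∀ x y : ℝ, 0 ≤ x → x ≤ y → x ^ γ ≤ y ^ γ := fun x y hx hxy =>
    Real.rpow_le_rpow hx hxy hγ0.le
  have hfm : ∀ x y, 0 ≤ x → x ≤ y → y ≤ 1 → m * (y ^ γ - x ^ γ) ≤ f x - f y := by
    intro x y hx hxy hy
    rw [hfeq x hx, hfeq y (hx.trans hxy)]
    have := hFm _ _ (hpow y ⟨hx.trans hxy, hy⟩).1 (neg_le_neg (hpowm x y hx hxy))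
      (hpow x ⟨hx, hxy.trans hy⟩).2
    linarith
  have hfM : ∀ x y, 0 ≤ x → x ≤ y → y ≤ 1 → f x - f y ≤ M * (y ^ γ - x ^ γ) := by
    intro x y hx hxy hy
    rw [hfeq x hx, hfeq y (hx.trans hxy)]
    have := hFM _ _ (hpow y ⟨hx.trans hxy, hy⟩).1 (neg_le_neg (hpowm x y hx hxy))
      (hpow x ⟨hx, hxy.trans hy⟩).2
    linarith
  have hanti : StrictAntiOn f (Icc 0 1) := by
    intro x hx y hy hxy
    have h1 := hfm x y hx.1 hxy.le hy.2
    have h2 := Real.rpow_lt_rpow hx.1 hxy hγ0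
    nlinarith
  have hf1 : f 1 = -1 := by rw [hfeq 1 zero_le_one, Real.one_rpow, hfix]
  have hf0 : f 0 = 1 + e := by rw [hfeq 0 le_rfl, Real.zero_rpow hγ0.ne', neg_zero, hF0]
  have hcont : ContinuousOn f (Icc 0 1) := by
    have h1 : ContinuousOn (fun t => F (-(t ^ γ))) (Icc 0 1) := fun x hx => by
      simpa only [neg_neg] using ((hud x hx).fun_neg).continuousWithinAt
    exact h1.congr fun x hx => hfeq x hx.1
  have hsurj : ∀ y ∈ Icc (-1 : ℝ) 1, ∃ x ∈ Icc (0 : ℝ) 1, f x = y := by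
    intro y hy
    have := intermediate_value_Icc' zero_le_one hcont
    rw [hf1, hf0] at this
    exact this ⟨hy.1, by linarith [hy.2]⟩
  have hpmem : ∀ y ∈ Icc (-1 : ℝ) 1, p y ∈ Icc (0 : ℝ) 1 := fun y hy =>
    Function.invFunOn_mem (hsurj y hy)
  have hfp : ∀ y ∈ Icc (-1 : ℝ) 1, f (p y) = y := fun y hy => Function.invFunOn_eq (hsurj y hy)
  have hpf : ∀ x ∈ Icc (0 : ℝ) 1, f x ∈ Icc (-1 : ℝ) 1 → p (f x) = x := fun x hx hfx =>
    hanti.injOn (hpmem _ hfx) hx (hfp _ hfx)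
  have hpanti : StrictAntiOn p (Icc (-1) 1) := by
    intro x hx y hy hxy
    rw [← hanti.lt_iff_gt (hpmem x hx) (hpmem y hy), hfp x hx, hfp y hy]
    exact hxy
  have hp1 : p (-1) = 1 := by
    have := hpf 1 (by simp) (by rw [hf1]; simp)
    rwa [hf1] at this
  have hN : ∀ x ∈ Icc (0 : ℝ) 1, ∀ y ∈ Icc (0 : ℝ) 1, x ≤ y →
      (y - x) ^ 2 * ((F₁ (-(x ^ γ)) * (γ * x ^ (γ - 1))) * (F₁ (-(y ^ γ)) * (γ * y ^ (γ - 1)))) ≤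
        (-F (-(y ^ γ)) - -F (-(x ^ γ))) ^ 2 := by
    intro x hx y hy hxy
    have hs : Icc (-(y ^ γ)) (-(x ^ γ)) ⊆ Icc (-1) 0 := Icc_subset_Icc (hpow y hy).1 (hpow x hx).2
    have h1 := sq_mul_deriv_le_of_schwarzian (neg_le_neg (hpowm x y hx.1 hxy))
      (fun t ht => (hd1 t (hs ht)).mono hs) (fun t ht => (hd2 t (hs ht)).mono hs)
      (fun t ht => (hd3 t (hs ht)).mono hs) (fun t ht => hm.trans_le (hF1 t (hs ht)).1)
      fun t ht => hS t (hs ht)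
    have h2 := sq_mul_deriv_rpow_le hγ hx.1 hxy
    have h3 : 0 ≤ F₁ (-(x ^ γ)) * F₁ (-(y ^ γ)) := mul_nonneg
      (hm.le.trans (hF1 _ (hpow x hx)).1) (hm.le.trans (hF1 _ (hpow y hy)).1)
    have h4 := mul_le_mul_of_nonneg_right h2 h3
    calc _ = _ := by ring
      _ ≤ _ := h4
      _ = (-x ^ γ - -y ^ γ) ^ 2 * (F₁ (-y ^ γ) * F₁ (-x ^ γ)) := by ring
      _ ≤ _ := h1
      _ = _ := by ring
  have hcr : CrossRatioContracting p := by
    refine ⟨Or.inr hpanti, fun y hy => ⟨by linarith [(hpmem y hy).1], (hpmem y hy).2⟩, ?_, ?_⟩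
    · intro a ha b hb
      have hab : uIcc a b ⊆ Icc (-1) 1 := ordConnected_Icc.uIcc_subset ha hb
      have hpab : uIcc (p a) (p b) ⊆ Icc 0 1 :=
        ordConnected_Icc.uIcc_subset (hpmem a ha) (hpmem b hb)
      refine Subset.antisymm (hpanti.antitoneOn.mono hab).image_uIcc_subset fun x hx => ?_
      have h1 : f x ∈ uIcc a b := by
        have := (hanti.antitoneOn.mono hpab).mapsTo_uIcc hx
        rwa [hfp a ha, hfp b hb] at this
      exact ⟨f x, h1, hpf x (hpab hx) (hab h1)⟩
    · intro a b c d ha hab hbc hcd hd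
      have ha' : a ∈ Icc (-1 : ℝ) 1 := ⟨ha, by linarith⟩
      have hb' : b ∈ Icc (-1 : ℝ) 1 := ⟨by linarith, by linarith⟩
      have hc' : c ∈ Icc (-1 : ℝ) 1 := ⟨by linarith, by linarith⟩
      have hd' : d ∈ Icc (-1 : ℝ) 1 := ⟨by linarith, hd⟩
      have e1 := hpanti ha' hb' hab
      have e2 := hpanti hb' hc' hbc
      have e3 := hpanti hc' hd' hcd
      have h1 := cross_ratio_le_of_sq_mul_deriv_le hud (fun x hx y hy hxy => by
        have := hanti hx hy hxy
        rw [hfeq x hx.1, hfeq y hy.1] at this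
        exact neg_lt_neg this) hN (hpmem d hd').1 e3 e2 e1 (hpmem a ha').2
      rw [← hfeq _ (hpmem a ha').1, ← hfeq _ (hpmem b hb').1, ← hfeq _ (hpmem c hc').1,
        ← hfeq _ (hpmem d hd').1, hfp a ha', hfp b hb', hfp c hc', hfp d hd'] at h1
      rw [abs_of_pos (by linarith), abs_of_pos (by linarith), abs_of_pos (by linarith),
        abs_of_pos (by linarith)]
      linarith
  have hup : ∀ y ∈ Icc (-1 : ℝ) 1, m * (1 - p y) ≤ y + 1 := by
    intro y hy
    have h1 := hfm (p y) 1 (hpmem y hy).1 (hpmem y hy).2 le_rfl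
    rw [hfp y hy, hf1, Real.one_rpow] at h1
    have h2 : p y ^ γ ≤ p y := by
      simpa using Real.rpow_le_rpow_of_exponent_ge' (hpmem y hy).1 (hpmem y hy).2 zero_le_one hγ.le
    nlinarith
  refine ⟨⟨hcr, hpanti, fun x hx => (hpmem x hx).1, hp1, ?_, ?_, ?_, ?_⟩, ?_⟩
  · intro x hx y hy hxy
    have h0 := hpanti.antitoneOn hx hy hxy
    have h1 := hfM (p y) (p x) (hpmem y hy).1 h0 (hpmem x hx).2
    rw [hfp x hx, hfp y hy] at h1
    have h2 := rpow_sub_rpow_le hγ.le (hpmem y hy).1 h0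
    have h3 := Real.rpow_le_one (hpmem x hx).1 (hpmem x hx).2 (by linarith : 0 ≤ γ - 1)
    rw [div_mul_eq_mul_div, one_mul, div_le_iff₀ (by positivity)]
    have h4 : p x ^ γ - p y ^ γ ≤ γ * (p x - p y) :=
      h2.trans (mul_le_mul_of_nonneg_right (by nlinarith) (by linarith))
    nlinarith
  · intro y hy
    rw [div_mul_eq_mul_div, one_mul, le_div_iff₀ hm]
    linarith [hup y hy]
  · intro y hy
    have hy1 : y ≤ 1 := by nlinarith [hy.2, hx₀.1, hx₀.2]
    have hy' : y ∈ Icc (-1 : ℝ) 1 := ⟨hy.1, hy1⟩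
    have hpy := hpmem y hy'
    have h1 : x₀ ≤ p y := by
      have := hup y hy'
      have h2 : m * (1 - p y) ≤ m * (1 - x₀) := by linarith [hy.2]
      linarith [le_of_mul_le_mul_left h2 hm]
    have hle : -(p y ^ γ) ≤ -(x₀ ^ γ) := neg_le_neg (hpowm _ _ hx₀.1.le h1)
    have hs : Icc (-1) (-(p y ^ γ)) ⊆ Icc (-1) 0 := Icc_subset_Icc le_rfl (hpow _ hpy).2
    have h2 : m₁ * (-(p y ^ γ) - -1) ≤ F (-(p y ^ γ)) - F (-1) :=
      mul_sub_le_of_le_deriv (hpow _ hpy).1 (fun x hx => (hd1 x (hs hx)).mono hs) fun x hx =>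
        hF1' x ⟨hx.1, hx.2.trans hle⟩
    rw [← hfeq _ hpy.1, hfp y hy', hfix] at h2
    have h3 := le_rpow_sub_rpow hγ.le hpy.1 hpy.2
    rw [Real.one_rpow] at h3
    have h4 : x₀ ^ (γ - 1) ≤ p y ^ (γ - 1) := Real.rpow_le_rpow hx₀.1.le h1 (by linarith)
    have h5 : 0 ≤ 1 - p y := by linarith [hpy.2]
    have h6 : γ * x₀ ^ (γ - 1) * (1 - p y) ≤ γ * p y ^ (γ - 1) * (1 - p y) :=
      mul_le_mul_of_nonneg_right (mul_le_mul_of_nonneg_left h4 hγ0.le) h5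
    have h7 : m₁ * (γ * x₀ ^ (γ - 1) * (1 - p y)) ≤ y + 1 :=
      (mul_le_mul_of_nonneg_left (h6.trans h3) hm₁.le).trans (by linarith)
    calc 1 - p y ≤ ((1 - κ) * (m₁ * (γ * x₀ ^ (γ - 1)))) * (1 - p y) := by nlinarith
      _ = (1 - κ) * (m₁ * (γ * x₀ ^ (γ - 1) * (1 - p y))) := by ring
      _ ≤ _ := mul_le_mul_of_nonneg_left h7 (by linarith)
  · intro x y hx hxy hy hA
    have hx' : x ∈ Icc (-1 : ℝ) 1 := ⟨hx, by linarith⟩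
    have hy' : y ∈ Icc (-1 : ℝ) 1 := ⟨by linarith, hy.le⟩
    have h1' : (1 : ℝ) ∈ Icc (-1 : ℝ) 1 := by simp
    set A := 1 / m / (κ * (1 / (γ * M))) with hAdef
    have hA0 : 0 ≤ A := by
      by_contra! hneg
      nlinarith
    have hab := hpanti hy' h1' hy
    have hbc := hpanti.antitoneOn hx' hy' hxy
    have ha0 := (hpmem 1 h1').1
    have hlow := hfm _ _ ha0 hab.le (hpmem y hy').2
    have hupp := hfM _ _ (hpmem y hy').1 hbc (hpmem x hx').2
    have hc1 := (hpmem x hx').2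
    rw [hfp _ hy', hfp _ h1'] at hlow
    rw [hfp _ hx', hfp _ hy'] at hupp
    generalize p 1 = a at *
    generalize p y = b at *
    generalize p x = c at *
    have hb0 : 0 < b := by linarith
    have hK : 0 ≤ A * M * (γ * 2 ^ (γ - 1)) / m := by positivity
    have hcb : 0 ≤ c - b := by linarith
    rcases le_total (2 * b) c with h2b | h2b
    · nlinarith
    · have r1 := rpow_sub_one_mul_sub_le hγ ha0 hab.le
      have r2 := rpow_sub_rpow_le hγ.le hb0.le hbc
      have r3 : c ^ (γ - 1) ≤ 2 ^ (γ - 1) * b ^ (γ - 1) := by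
        rw [← Real.mul_rpow zero_le_two hb0.le]
        exact Real.rpow_le_rpow (by linarith) h2b (by linarith)
      have hbp : 0 < b ^ (γ - 1) := Real.rpow_pos_of_pos hb0 _
      have r4 : c ^ γ - b ^ γ ≤ γ * (2 ^ (γ - 1) * b ^ (γ - 1)) * (c - b) :=
        r2.trans (mul_le_mul_of_nonneg_right (mul_le_mul_of_nonneg_left r3 hγ0.le) hcb)
      have r5 : b ^ (γ - 1) * (m * (b - a)) ≤
          b ^ (γ - 1) * (A * M * (γ * 2 ^ (γ - 1)) * (c - b)) := by
        calc b ^ (γ - 1) * (m * (b - a)) = m * (b ^ (γ - 1) * (b - a)) := by ring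
          _ ≤ m * (b ^ γ - a ^ γ) := mul_le_mul_of_nonneg_left r1 hm.le
          _ ≤ 1 - y := hlow
          _ ≤ A * (y - x) := hA
          _ ≤ A * (M * (γ * (2 ^ (γ - 1) * b ^ (γ - 1)) * (c - b))) :=
            mul_le_mul_of_nonneg_left (hupp.trans (mul_le_mul_of_nonneg_left r4 hM.le)) hA0
          _ = _ := by ring
      have r6 := le_of_mul_le_mul_left r5 hbp
      have r7 : b - a ≤ A * M * (γ * 2 ^ (γ - 1)) / m * (c - b) := by
        rw [div_mul_eq_mul_div, le_div_iff₀ hm]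
        linarith
      linarith
  · intro y hy
    have hex : ∃ x ∈ Icc (-1 : ℝ) 0, f x = y := by
      obtain ⟨x, hx, hxy⟩ := hsurj y hy
      exact ⟨-x, ⟨by linarith [hx.2], by linarith [hx.1]⟩, by rwa [heven]⟩
    have h1 : branch f false y ∈ Icc (-1 : ℝ) 0 := Function.invFunOn_mem hex
    have h2 : f (branch f false y) = y := Function.invFunOn_eq hex
    have h3 : f (-branch f false y) = y := by
      rwa [heven]
    have h4 := hanti.injOn (hpmem y hy) ⟨by linarith [h1.2], by linarith [h1.1]⟩
      ((hfp y hy).trans h3.symm)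
    change branch f false y = -p y
    rw [h4, neg_neg]


theorem continuousOn_deriv_snd {Φ Φ' : ℝ → ℝ → ℝ} {a b c d : ℝ} (hab : a < b) (hcd : c < d)
    (hd : ∀ ε ∈ Icc a b, ∀ x ∈ Icc c d, HasDerivWithinAt (Φ ε) (Φ' ε x) (Icc c d) x)
    (hC : ContDiffOn ℝ 1 (fun q : ℝ × ℝ => Φ q.1 q.2) (Icc a b ×ˢ Icc c d)) :
    ContinuousOn (fun q : ℝ × ℝ => Φ' q.1 q.2) (Icc a b ×ˢ Icc c d) := by
  have hu : UniqueDiffOn ℝ (Icc a b ×ˢ Icc c d) := (uniqueDiffOn_Icc hab).prod (uniqueDiffOn_Icc hcd)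
  have h1 := (hC.continuousOn_fderivWithin hu le_rfl).clm_apply
    (continuousOn_const (c := ((0 : ℝ), (1 : ℝ))))
  refine h1.congr fun q hq => ?_
  have h2 := (hC.differentiableOn one_ne_zero q hq).hasFDerivWithinAt
  have h3 : HasDerivWithinAt (fun x : ℝ => (q.1, x)) ((0 : ℝ), (1 : ℝ)) (Icc c d) q.2 :=
    (hasDerivWithinAt_const _ _ _).prodMk (hasDerivWithinAt_id _ _)
  have h4 := HasFDerivWithinAt.comp_hasDerivWithinAt (f := fun x : ℝ => (q.1, x)) q.2 h2 h3
    fun x hx => ⟨hq.1, hx⟩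
  exact (uniqueDiffOn_Icc hcd q.2 hq.2).eq_deriv _ (hd q.1 hq.1 q.2 hq.2) h4

/-- Near a compact slice on which a continuous function exceeds `k`, it uniformly exceeds `k`. -/
theorem exists_lt_forall_le_of_continuousOn {Ψ : ℝ → ℝ → ℝ} {a b c d k : ℝ} (hab : a ≤ b)
    (hcd : c ≤ d) (hc : ContinuousOn (fun q : ℝ × ℝ => Ψ q.1 q.2) (Icc a b ×ˢ Icc c d))
    (hk : ∀ ε ∈ Icc a b, k < Ψ ε c) :
    ∃ k' > k, ∃ δ > 0, ∀ ε ∈ Icc a b, ∀ x ∈ Icc c d, x - c < δ → k' ≤ Ψ ε x := by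
  have h1 : ContinuousOn (fun ε => Ψ ε c) (Icc a b) :=
    hc.comp (f := fun ε : ℝ => (ε, c)) (by fun_prop) fun ε hε => ⟨hε, le_rfl, hcd⟩
  obtain ⟨ε₁, hε₁, hmin⟩ := isCompact_Icc.exists_isMinOn (nonempty_Icc.2 hab) h1
  have h2 := hk ε₁ hε₁
  have huc := (isCompact_Icc.prod isCompact_Icc).uniformContinuousOn_of_continuous hc
  obtain ⟨δ, hδ, H⟩ := Metric.uniformContinuousOn_iff.1 huc ((Ψ ε₁ c - k) / 2) (by linarith)
  refine ⟨(Ψ ε₁ c + k) / 2, by linarith, δ, hδ, fun ε hε x hx hxδ => ?_⟩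
  have h3 := H (ε, x) ⟨hε, hx⟩ (ε, c) ⟨hε, le_rfl, hcd⟩ (by
    rw [Prod.dist_eq, dist_self, Real.dist_eq, abs_of_nonneg (by simpa using hx.1)]
    exact max_lt hδ hxδ)
  rw [Real.dist_eq] at h3
  have h4 : Ψ ε₁ c ≤ Ψ ε c := hmin hε
  linarith [(abs_lt.1 h3).1]


/-- Lemma 11: for the family `f_ε(x) = F_ε(-|x|^γ)` built from C³
embeddings `F_ε` of `[-1,0]` with nonpositive Schwarzian derivative (as in Proposition 1),
there is a constant `C > 0` independent of `ε` such that for every pair `(J, I)` with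
`J ∈ η_{n+1,ε}`, `I ∈ η_{n,ε}` and `J ⊆ I`, one has `|J|/|I| ≥ C`. -/
theorem uniform_bounded_geometry (eps0 : ℝ) (heps0 : 0 < eps0) (γ : ℝ) (hγ : 1 < γ)
    (F F' F'' F''' : ℝ → ℝ → ℝ)
    (hd1 : ∀ ε ∈ Icc 0 eps0, ∀ x ∈ Icc (-1:ℝ) 0,
      HasDerivWithinAt (F ε) (F' ε x) (Icc (-1) 0) x)
    (hd2 : ∀ ε ∈ Icc 0 eps0, ∀ x ∈ Icc (-1:ℝ) 0,
      HasDerivWithinAt (F' ε) (F'' ε x) (Icc (-1) 0) x)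
    (hd3 : ∀ ε ∈ Icc 0 eps0, ∀ x ∈ Icc (-1:ℝ) 0,
      HasDerivWithinAt (F'' ε) (F''' ε x) (Icc (-1) 0) x)
    (hcont3 : ∀ ε ∈ Icc 0 eps0, ContinuousOn (F''' ε) (Icc (-1) 0))
    (hemb : ∀ ε ∈ Icc 0 eps0, Set.InjOn (F ε) (Icc (-1) 0))
    (hne : ∀ ε ∈ Icc 0 eps0, ∀ x ∈ Icc (-1:ℝ) 0, F' ε x ≠ 0)
    (hschwarz : ∀ ε ∈ Icc 0 eps0, ∀ x ∈ Icc (-1:ℝ) 0,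
      F''' ε x / F' ε x - (3 / 2) * (F'' ε x / F' ε x) ^ 2 ≤ 0)
    (hfix : ∀ ε ∈ Icc 0 eps0, F ε (-1) = -1)
    (hmap0 : ∀ ε ∈ Icc 0 eps0, F ε 0 = 1 + ε)
    (hexp : ∀ ε ∈ Icc 0 eps0, F' ε (-1) > 1 / γ)
    (hC2 : ContDiffOn ℝ 2 (fun p : ℝ × ℝ => F p.1 p.2) (Icc 0 eps0 ×ˢ Icc (-1) 0)) :
    ∃ C > (0:ℝ), ∀ ε ∈ Icc 0 eps0, ∀ n : ℕ, ∀ wI wJ : List Bool,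
      wI.length = n + 1 → wJ.length = n + 2 →
      Iw (fun x => F ε (-(|x| ^ γ))) wJ ⊆ Iw (fun x => F ε (-(|x| ^ γ))) wI →
      len (Iw (fun x => F ε (-(|x| ^ γ))) wJ) /
        len (Iw (fun x => F ε (-(|x| ^ γ))) wI) ≥ C := by
  have hcF := continuousOn_deriv_snd heps0 (by norm_num : (-1 : ℝ) < 0) hd1
    (hC2.of_le (by norm_num))
  have hγ0 : 0 < γ := by linarith
  have hpos : ∀ ε ∈ Icc 0 eps0, ∀ x ∈ Icc (-1 : ℝ) 0, 0 < F' ε x := by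
    intro ε hε x hx
    by_contra! hneg
    have hsub : Icc (-1) x ⊆ Icc (-1) 0 := Icc_subset_Icc le_rfl hx.2
    have hc : ContinuousOn (F' ε) (Icc (-1) x) := fun t ht =>
      ((hd2 ε hε t (hsub ht)).continuousWithinAt).mono hsub
    have h0 : (0 : ℝ) ∈ Icc (F' ε x) (F' ε (-1)) :=
      ⟨hneg, ((by positivity : 0 < 1 / γ).trans (hexp ε hε)).le⟩
    obtain ⟨t, ht, ht0⟩ := intermediate_value_Icc' hx.1 hc h0
    exact hne ε hε t (hsub ht) ht0
  have hK : IsCompact (Icc 0 eps0 ×ˢ Icc (-1 : ℝ) 0) := isCompact_Icc.prod isCompact_Icc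
  have hKne : (Icc 0 eps0 ×ˢ Icc (-1 : ℝ) 0).Nonempty := ⟨(0, 0), by simp [heps0.le]⟩
  obtain ⟨q₁, hq₁, hmin⟩ := hK.exists_isMinOn hKne hcF
  obtain ⟨q₂, hq₂, hmax⟩ := hK.exists_isMaxOn hKne hcF
  obtain ⟨m₁, hm₁, δ, hδ, hloc⟩ := exists_lt_forall_le_of_continuousOn heps0.le
    (by norm_num : (-1 : ℝ) ≤ 0) hcF hexp
  have hm₁0 : 0 < m₁ := (by positivity : 0 < 1 / γ).trans hm₁
  have hm₁γ : 1 < m₁ * (γ * (1 : ℝ) ^ (γ - 1)) := by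
    rw [Real.one_rpow, mul_one]
    rwa [gt_iff_lt, div_lt_iff₀ hγ0] at hm₁
  obtain ⟨x₀, hx₀, hx₀δ, hx₀γ⟩ : ∃ x₀ ∈ Ioo (0 : ℝ) 1, 1 - x₀ ^ γ < δ ∧
      1 < m₁ * (γ * x₀ ^ (γ - 1)) := by
    have t1 : ContinuousAt (fun x : ℝ => 1 - x ^ γ) 1 :=
      continuousAt_const.sub (Real.continuousAt_rpow_const _ _ (Or.inl one_ne_zero))
    have t2 : ContinuousAt (fun x : ℝ => m₁ * (γ * x ^ (γ - 1))) 1 :=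
      continuousAt_const.mul
        (continuousAt_const.mul (Real.continuousAt_rpow_const _ _ (Or.inl one_ne_zero)))
    have e1 := t1.eventually_lt_const (u := δ) (by simpa using hδ)
    have e2 := t2.eventually_const_lt hm₁γ
    obtain ⟨x, ⟨hx1, hx2⟩, hx⟩ := (((e1.and e2).filter_mono nhdsWithin_le_nhds).and
      (Ioo_mem_nhdsLT (zero_lt_one' ℝ))).exists
    exact ⟨x, hx, hx1, hx2⟩
  set μ := m₁ * (γ * x₀ ^ (γ - 1)) with hμ
  set m := min 1 (F' q₁.1 q₁.2) with hm
  set M := F' q₂.1 q₂.2 with hM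
  have hm0 : 0 < m := lt_min one_pos (hpos _ hq₁.1 _ hq₁.2)
  have hM0 : 0 < M := hpos _ hq₂.1 _ hq₂.2
  have hμ0 : 0 < μ := by linarith
  have hκ0 : 0 < 1 - 1 / μ := by rw [sub_pos, div_lt_one hμ0]; exact hx₀γ
  have hκ1 : 1 - 1 / μ < 1 := by linarith [one_div_pos.2 hμ0]
  have hx₀' : 0 < 1 - x₀ := by linarith [hx₀.2]
  have key := fun ε (hε : ε ∈ Icc 0 eps0) =>
    branchBounds_of_schwarzian (e := ε) (m := m) (M := M) (m₁ := m₁) (x₀ := x₀)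
      (κ := 1 - 1 / μ) hγ hε.1 (hd1 ε hε) (hd2 ε hε) (hd3 ε hε)
      (fun x hx => by
        have h1 := hpos ε hε x hx
        have h2 := mul_le_mul_of_nonneg_right (hschwarz ε hε x hx) (sq_nonneg (F' ε x))
        have h3 : (F''' ε x / F' ε x - (3 / 2) * (F'' ε x / F' ε x) ^ 2) * F' ε x ^ 2 =
            F''' ε x * F' ε x - 3 / 2 * F'' ε x ^ 2 := by
          field_simp
        linarith)
      hm0 (min_le_left _ _)
      (fun x hx => ⟨(min_le_right _ _).trans (hmin (a := (ε, x)) ⟨hε, hx⟩),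
        hmax (a := (ε, x)) ⟨hε, hx⟩⟩)
      (hfix ε hε) (hmap0 ε hε) hm₁0 hx₀
      (fun x hx => hloc ε hε x ⟨hx.1, hx.2.trans (neg_nonpos.2 (Real.rpow_nonneg hx₀.1.le _))⟩
        (by linarith [hx.2]))
      hκ1 (by rw [← hμ]; apply le_of_eq; field_simp; ring)
  have hs1 : m * (1 - x₀) ≤ 1 := mul_le_one₀ (min_le_left _ _) hx₀'.le (by linarith [hx₀.1])
  have hs0 : 0 < m * (1 - x₀) := by positivity
  obtain ⟨C, hC, H⟩ := BranchBounds.exists_pos_mul_le (c := 1 / (γ * M)) (L := 1 / m)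
    (κ := 1 - 1 / μ) (s := -1 + m * (1 - x₀))
    (D := 1 + 1 / m / ((1 - 1 / μ) * (1 / (γ * M))) * M * (γ * 2 ^ (γ - 1)) / m)
    (by positivity) (by positivity) hκ0 hκ1 (by linarith) (by linarith) (by positivity)
  refine ⟨1 / C, by positivity, ?_⟩
  intro ε hε n wI wJ hI hJ hsub
  obtain ⟨hbb, hfalse⟩ := key ε hε
  have htrue : EqOn (branch (fun x => F ε (-(|x| ^ γ))) true)
    (branch (fun x => F ε (-(|x| ^ γ))) true) (Icc (-1) 1) := fun _ _ => rfl
  obtain ⟨b, rfl⟩ := hbb.exists_eq_concat_of_subset htrue hfalse (by omega) hsub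
  have hle := H _ _ hbb htrue hfalse wI (by rintro rfl; simp at hI) b
  rw [hbb.len_Iw htrue hfalse, hbb.len_Iw htrue hfalse]
  have hI0 : 0 < |gw (fun x => F ε (-(|x| ^ γ))) wI (-1) -
      gw (fun x => F ε (-(|x| ^ γ))) wI 1| := by
    refine abs_pos.2 (sub_ne_zero.2 fun h => ?_)
    have := (hbb.gw_cr htrue hfalse wI).injOn (by simp) (by simp) h
    norm_num at this
  rw [ge_iff_le, div_le_div_iff₀ hC hI0]
  linarith
end
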